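/- arXiv:1902.10179 — 2 statements merged into one kernel-verified Lean document; each statement's English description precedes it below -/
import Mathlib

section
/- Let d ≥ 2, U(n) = α n^d + α_{d-1} n^{d-1} + ⋯ + α₁ n with real coefficients, where |α - a/q| ≤ C/q² with 1 ≤ a < q, gcd(a,q) = 1, C ≥ 1. Set κ = 2^{1-d}. Then there is a constant A = A(d) such that for any Z > 1 and y > 1, |∑_{n ≤ y} e(U(n))| ≪_d y · (CZ/q + (CZ/y) log q + CZ q log q / y^d + (log^A y)/Z)^κ, where e(θ) = e^{2πiθ}. -/
open Finset Complex

/-- `e(θ) = e^{2πiθ}`. -/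
noncomputable def eTwoPi (θ : ℝ) : ℂ := Complex.exp (2 * Real.pi * Complex.I * θ)

theorem card_divisors_mul_le (m n : ℕ) :
    (m * n).divisors.card ≤ m.divisors.card * n.divisors.card := by
  rw [Nat.divisors_mul]
  exact Finset.card_mul_le

theorem sum_card_divisors_mul (X : ℕ) (g : ℕ → ℝ) :
    ∑ n ∈ Icc 1 X, (n.divisors.card : ℝ) * g n =
      ∑ a ∈ Icc 1 X, ∑ b ∈ Icc 1 (X / a), g (a * b) := by
  simp_rw [← nsmul_eq_mul, ← Finset.sum_const]
  rw [Finset.sum_comm' (t' := Icc 1 X) (s' := fun a => (Icc 1 X).filter (a ∣ ·))]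
  · refine Finset.sum_congr rfl fun a ha => ?_
    have ha0 : 0 < a := (mem_Icc.1 ha).1
    symm
    refine Finset.sum_bij (fun b _ => a * b) ?_ ?_ ?_ ?_
    · intro b hb
      rw [mem_Icc, Nat.le_div_iff_mul_le ha0] at hb
      simp only [mem_filter, mem_Icc, dvd_mul_right, and_true]
      exact ⟨Nat.mul_pos ha0 hb.1, by linarith [mul_comm a b]⟩
    · intro b _ c _ h
      exact Nat.eq_of_mul_eq_mul_left ha0 h
    · intro n hn
      simp only [mem_filter, mem_Icc] at hn
      obtain ⟨⟨h1, h2⟩, b, rfl⟩ := hn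
      refine ⟨b, ?_, rfl⟩
      rw [mem_Icc, Nat.le_div_iff_mul_le ha0]
      exact ⟨Nat.pos_of_mul_pos_left h1, by linarith [mul_comm a b]⟩
    · intros; rfl
  · intro n a
    simp only [mem_Icc, Nat.mem_divisors, mem_filter]
    constructor
    · rintro ⟨⟨h1, h2⟩, h3, h4⟩
      exact ⟨⟨⟨h1, h2⟩, h3⟩, Nat.pos_of_dvd_of_pos h3 h1, (Nat.le_of_dvd h1 h3).trans h2⟩
    · rintro ⟨⟨⟨h1, h2⟩, h3⟩, h4⟩
      exact ⟨⟨h1, h2⟩, h3, by omega⟩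

theorem card_divisors_mul_pow_le (m n j : ℕ) :
    ((m * n).divisors.card : ℝ) ^ j ≤ (m.divisors.card : ℝ) ^ j * (n.divisors.card : ℝ) ^ j := by
  rw [← mul_pow]
  gcongr
  exact_mod_cast card_divisors_mul_le m n

theorem sum_card_divisors_pow_div_le (j X : ℕ) :
    ∑ n ∈ Icc 1 X, (n.divisors.card : ℝ) ^ j / n ≤ (1 + Real.log X) ^ 2 ^ j := by
  induction j with
  | zero =>
    have h := harmonic_le_one_add_log X
    rw [harmonic_eq_sum_Icc] at h
    push_cast at h
    simpa using h
  | succ j ih =>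
    have h : ∀ n ∈ Icc 1 X, (n.divisors.card : ℝ) ^ (j + 1) / n =
        n.divisors.card * ((n.divisors.card : ℝ) ^ j / n) := fun n _ => by ring
    rw [Finset.sum_congr rfl h, sum_card_divisors_mul X fun n => (n.divisors.card : ℝ) ^ j / n,
      pow_succ, pow_mul, sq]
    calc _ ≤ ∑ a ∈ Icc 1 X, ∑ b ∈ Icc 1 X,
          ((a.divisors.card : ℝ) ^ j / a) * ((b.divisors.card : ℝ) ^ j / b) := by
          refine Finset.sum_le_sum fun a _ => ?_
          refine (Finset.sum_le_sum fun b _ => ?_).trans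
            (Finset.sum_le_sum_of_subset_of_nonneg
              (Icc_subset_Icc_right (Nat.div_le_self X a)) fun _ _ _ => by positivity)
          rw [div_mul_div_comm, Nat.cast_mul]
          gcongr
          exact card_divisors_mul_pow_le a b j
      _ ≤ _ := by
          rw [← Finset.sum_mul_sum]
          exact mul_le_mul ih ih (by positivity) (by have := Real.log_natCast_nonneg X; positivity)

theorem sum_card_divisors_pow_le (j X : ℕ) :
    ∑ n ∈ Icc 1 X, (n.divisors.card : ℝ) ^ j ≤ X * (1 + Real.log X) ^ 2 ^ j := by
  induction j generalizing X with
  | zero =>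
    have := Real.log_natCast_nonneg X
    simp
    nlinarith [(Nat.cast_nonneg X : (0 : ℝ) ≤ X)]
  | succ j ih =>
    have hL := Real.log_natCast_nonneg X
    have h : ∀ n ∈ Icc 1 X, (n.divisors.card : ℝ) ^ (j + 1) =
        n.divisors.card * (n.divisors.card : ℝ) ^ j := fun n _ => by ring
    rw [Finset.sum_congr rfl h, sum_card_divisors_mul X fun n => (n.divisors.card : ℝ) ^ j]
    calc _ ≤ ∑ a ∈ Icc 1 X, (X * (1 + Real.log X) ^ 2 ^ j) * ((a.divisors.card : ℝ) ^ j / a) := by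
          refine Finset.sum_le_sum fun a ha => ?_
          calc _ ≤ ∑ b ∈ Icc 1 (X / a), (a.divisors.card : ℝ) ^ j * (b.divisors.card : ℝ) ^ j :=
                Finset.sum_le_sum fun b _ => card_divisors_mul_pow_le a b j
            _ ≤ (a.divisors.card : ℝ) ^ j * (X / a * (1 + Real.log X) ^ 2 ^ j) := by
                rw [← Finset.mul_sum]
                gcongr
                refine (ih (X / a)).trans ?_
                have := Real.log_natCast_nonneg (X / a)
                have h2 : Real.log ((X / a : ℕ) : ℝ) ≤ Real.log X := by
                  rcases Nat.eq_zero_or_pos (X / a) with h0 | h0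
                  · simpa [h0] using hL
                  · exact Real.log_le_log (by exact_mod_cast h0)
                      (by exact_mod_cast Nat.div_le_self X a)
                gcongr
                exact Nat.cast_div_le
            _ = _ := by ring
      _ ≤ (X * (1 + Real.log X) ^ 2 ^ j) * (1 + Real.log X) ^ 2 ^ j := by
          rw [← Finset.mul_sum]
          gcongr
          exact sum_card_divisors_pow_div_le j X
      _ = _ := by ring

theorem eTwoPi_add (x y : ℝ) : eTwoPi (x + y) = eTwoPi x * eTwoPi y := by
  rw [eTwoPi, eTwoPi, eTwoPi, ← Complex.exp_add]
  push_cast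
  ring_nf

theorem norm_eTwoPi (x : ℝ) : ‖eTwoPi x‖ = 1 := by
  rw [eTwoPi, show 2 * (Real.pi : ℂ) * I * x = ((2 * Real.pi * x : ℝ) : ℂ) * I by push_cast; ring]
  exact Complex.norm_exp_ofReal_mul_I _

theorem eTwoPi_intCast (n : ℤ) : eTwoPi n = 1 := by
  rw [eTwoPi, Complex.exp_eq_one_iff]
  exact ⟨n, by push_cast; ring⟩

theorem eTwoPi_natCast_mul (n : ℕ) (x : ℝ) : eTwoPi (n * x) = eTwoPi x ^ n := by
  rw [eTwoPi, eTwoPi, ← Complex.exp_nat_mul]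
  push_cast
  ring_nf

theorem eTwoPi_mul_conj (x y : ℝ) :
    eTwoPi x * (starRingEnd ℂ) (eTwoPi y) = eTwoPi (x - y) := by
  have h : (starRingEnd ℂ) (eTwoPi y) = eTwoPi (-y) := by
    rw [eTwoPi, eTwoPi, ← Complex.exp_conj]
    simp [map_ofNat]
  rw [h, ← eTwoPi_add, sub_eq_add_neg]

theorem four_mul_abs_sub_round_le (x : ℝ) : 4 * |x - round x| ≤ ‖eTwoPi x - 1‖ := by
  have h1 : eTwoPi x = Complex.exp (I * ((2 * Real.pi * (x - round x) : ℝ) : ℂ)) := by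
    have : eTwoPi x = eTwoPi (x - round x) := by
      conv_lhs => rw [← sub_add_cancel x (round x : ℝ), eTwoPi_add, eTwoPi_intCast, mul_one]
    rw [this, eTwoPi]
    push_cast
    ring_nf
  have h2 := abs_sub_round x
  have hpi := Real.pi_pos
  rw [h1, norm_exp_I_mul_ofReal_sub_one, norm_mul, Real.norm_eq_abs, Real.norm_eq_abs,
    show 2 * Real.pi * (x - round x) / 2 = Real.pi * (x - round x) by ring]
  have h3 : |Real.pi * (x - round x)| = Real.pi * |x - round x| := by
    rw [abs_mul, abs_of_pos hpi]
  have h4 := Real.mul_abs_le_abs_sin (x := Real.pi * (x - round x)) (by rw [h3]; nlinarith)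
  rw [h3, ← mul_assoc, div_mul_cancel₀ _ hpi.ne'] at h4
  rw [abs_of_pos (by norm_num : (0 : ℝ) < 2)]
  linarith

/-- A majorant, within a constant factor, of `min N (1 / ‖θ‖)`, where `‖θ‖` is the distance from
`θ` to the nearest integer. -/
noncomputable def weylMajorant (N : ℕ) (θ : ℝ) : ℝ := 2 * N / (1 + N * |θ - round θ|)

theorem weylMajorant_nonneg (N : ℕ) (θ : ℝ) : 0 ≤ weylMajorant N θ := by
  unfold weylMajorant
  positivity

theorem weylMajorant_le (N : ℕ) (θ : ℝ) : weylMajorant N θ ≤ 2 * N :=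
  div_le_self (by positivity) (le_add_of_nonneg_right (by positivity))

/-- The exponential sum of a polynomial phase over `0 ≤ n < L`. -/
noncomputable def phaseSum (f : Polynomial ℝ) (L : ℕ) : ℂ :=
  ∑ n ∈ range L, eTwoPi (f.eval (n : ℝ))

theorem norm_phaseSum_le (f : Polynomial ℝ) (L : ℕ) : ‖phaseSum f L‖ ≤ L := by
  refine (norm_sum_le _ _).trans ?_
  simp [norm_eTwoPi]

theorem norm_phaseSum_le_weylMajorant {f : Polynomial ℝ} (hf : f.natDegree ≤ 1) {L N : ℕ}
    (hL : L ≤ N) : ‖phaseSum f L‖ ≤ weylMajorant N (f.coeff 1) := by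
  set z := eTwoPi (f.coeff 1) with hz
  have h1 : phaseSum f L = eTwoPi (f.coeff 0) * ∑ n ∈ range L, z ^ n := by
    rw [phaseSum, Finset.mul_sum]
    refine Finset.sum_congr rfl fun n _ => ?_
    rw [Polynomial.eval_eq_sum_range' (Nat.lt_succ_of_le hf), Finset.sum_range_succ,
      Finset.sum_range_one, pow_zero, mul_one, pow_one, eTwoPi_add, mul_comm (f.coeff 1),
      eTwoPi_natCast_mul]
  have h2 : ‖phaseSum f L‖ = ‖∑ n ∈ range L, z ^ n‖ := by
    rw [h1, norm_mul, norm_eTwoPi, one_mul]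
  have h3 : ‖∑ n ∈ range L, z ^ n‖ * ‖z - 1‖ ≤ 2 := by
    rw [← norm_mul, geom_sum_mul]
    refine (norm_sub_le _ _).trans ?_
    rw [norm_pow, hz, norm_eTwoPi]
    norm_num
  have h4 := four_mul_abs_sub_round_le (f.coeff 1)
  have h5 : ‖phaseSum f L‖ ≤ N := (norm_phaseSum_le f L).trans (by exact_mod_cast hL)
  have h6 : ‖phaseSum f L‖ * |f.coeff 1 - round (f.coeff 1)| ≤ 1 := by
    rw [← h2] at h3
    have := mul_le_mul_of_nonneg_left h4 (norm_nonneg (phaseSum f L))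
    linarith
  rw [weylMajorant, le_div_iff₀ (by positivity)]
  have := mul_le_mul_of_nonneg_left h6 (Nat.cast_nonneg (α := ℝ) N)
  linarith

theorem normSq_sum_range (z : ℕ → ℂ) (N L : ℕ) (hL : L ≤ N) :
    normSq (∑ n ∈ range L, z n) = ∑ n ∈ range L, normSq (z n) +
      2 * (∑ h ∈ Icc 1 N, ∑ n ∈ range (L - h), z (n + h) * (starRingEnd ℂ) (z n)).re := by
  induction L with
  | zero => simp
  | succ L ih =>
    rw [Finset.sum_range_succ, Finset.sum_range_succ, normSq_add, ih (by omega)]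
    have key : ∑ h ∈ Icc 1 N, ∑ n ∈ range (L + 1 - h), z (n + h) * (starRingEnd ℂ) (z n) =
        ∑ h ∈ Icc 1 N, ∑ n ∈ range (L - h), z (n + h) * (starRingEnd ℂ) (z n) +
          ∑ h ∈ Icc 1 L, z L * (starRingEnd ℂ) (z (L - h)) := by
      have hsub : Icc 1 L ⊆ Icc 1 N := Icc_subset_Icc_right (by omega)
      have hext : ∑ h ∈ Icc 1 L, z L * (starRingEnd ℂ) (z (L - h)) =
          ∑ h ∈ Icc 1 N, if h ≤ L then z L * (starRingEnd ℂ) (z (L - h)) else 0 := by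
        rw [← Finset.sum_filter]
        congr 1
        ext h
        simp only [mem_Icc, mem_filter]
        omega
      rw [hext, ← Finset.sum_add_distrib]
      refine Finset.sum_congr rfl fun h hh => ?_
      split_ifs with hhL
      · rw [Nat.sub_add_comm hhL, Finset.sum_range_succ, Nat.sub_add_cancel hhL]
      · rw [show L + 1 - h = 0 by omega, show L - h = 0 by omega, add_zero]
    have hrefl : ∑ h ∈ Icc 1 L, z L * (starRingEnd ℂ) (z (L - h)) =
        z L * (starRingEnd ℂ) (∑ n ∈ range L, z n) := by
      rw [map_sum, ← Finset.mul_sum, ← Finset.sum_range_reflect, ← Finset.Ico_add_one_right_eq_Icc,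
        Finset.sum_Ico_eq_sum_range]
      congr 1
      refine Finset.sum_congr (by simp) fun n _ => ?_
      congr 2
      omega
    rw [key, hrefl, Complex.add_re]
    have hre : ((∑ n ∈ range L, z n) * (starRingEnd ℂ) (z L)).re =
        (z L * (starRingEnd ℂ) (∑ n ∈ range L, z n)).re := by
      simp only [Complex.mul_re, Complex.conj_re, Complex.conj_im]
      ring
    rw [hre]
    ring

/-- The forward difference `f (X + h) - f X`. -/
noncomputable def shiftDiff (h : ℕ) (f : Polynomial ℝ) : Polynomial ℝ :=
  Polynomial.taylor (h : ℝ) f - f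

theorem norm_phaseSum_sq_le (f : Polynomial ℝ) {L N : ℕ} (hL : L ≤ N) :
    ‖phaseSum f L‖ ^ 2 ≤ N + 2 * ∑ h ∈ Icc 1 N, ‖phaseSum (shiftDiff h f) (L - h)‖ := by
  rw [← Complex.normSq_eq_norm_sq, phaseSum, normSq_sum_range _ N L hL]
  have h1 : ∑ n ∈ range L, normSq (eTwoPi (f.eval (n : ℝ))) ≤ N := by
    simp only [Complex.normSq_eq_norm_sq, norm_eTwoPi]
    simpa using hL
  refine add_le_add h1 (mul_le_mul_of_nonneg_left ?_ zero_le_two)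
  refine (Complex.re_le_norm _).trans ((norm_sum_le _ _).trans
    (Finset.sum_le_sum fun h _ => le_of_eq ?_))
  rw [phaseSum]
  congr 1
  refine Finset.sum_congr rfl fun n _ => ?_
  rw [eTwoPi_mul_conj, shiftDiff, Polynomial.eval_sub, Polynomial.taylor_eval]
  push_cast
  rfl

theorem natDegree_shiftDiff_le (h k : ℕ) {f : Polynomial ℝ} (hf : f.natDegree ≤ k + 1) :
    (shiftDiff h f).natDegree ≤ k := by
  rw [Polynomial.natDegree_le_iff_coeff_eq_zero]
  intro n hn
  have hc : (Polynomial.hasseDeriv n f).natDegree ≤ 0 :=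
    (Polynomial.natDegree_hasseDeriv_le f n).trans (by omega)
  rw [shiftDiff, Polynomial.coeff_sub, Polynomial.taylor_coeff,
    Polynomial.eq_C_of_natDegree_le_zero hc, Polynomial.eval_C, Polynomial.hasseDeriv_coeff]
  simp

theorem coeff_shiftDiff (h k : ℕ) {f : Polynomial ℝ} (hf : f.natDegree ≤ k + 1) :
    (shiftDiff h f).coeff k = (k + 1) * h * f.coeff (k + 1) := by
  have hc : (Polynomial.hasseDeriv k f).natDegree ≤ 1 :=
    (Polynomial.natDegree_hasseDeriv_le f k).trans (by omega)
  rw [shiftDiff, Polynomial.coeff_sub, Polynomial.taylor_coeff,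
    Polynomial.eval_eq_sum_range' (Nat.lt_succ_of_le hc), Finset.sum_range_succ,
    Finset.sum_range_one, Polynomial.hasseDeriv_coeff, Polynomial.hasseDeriv_coeff]
  rw [Nat.add_comm 1 k, Nat.choose_succ_self_right]
  simp
  ring

theorem weyl_differencing (k : ℕ) :
    ∃ K : ℝ, 0 < K ∧ ∀ (f : Polynomial ℝ) (L N : ℕ), f.natDegree ≤ k + 1 → 1 ≤ N → L ≤ N →
      ‖phaseSum f L‖ ^ 2 ^ k * (N : ℝ) ^ (k + 1) ≤
        K * (N : ℝ) ^ 2 ^ k * ((N : ℝ) ^ k + ∑ m ∈ Icc 1 (N ^ k), (m.divisors.card : ℝ) ^ k *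
          weylMajorant N ((k + 1).factorial * m * f.coeff (k + 1))) := by
  induction k with
  | zero =>
    refine ⟨1, one_pos, fun f L N hf hN hL => ?_⟩
    have h := norm_phaseSum_le_weylMajorant hf hL
    simp
    nlinarith [(Nat.cast_nonneg N : (0 : ℝ) ≤ N)]
  | succ k ih =>
    obtain ⟨K, hK, ih⟩ := ih
    refine ⟨4 ^ 2 ^ k * (1 + K), by positivity, fun f L N hf hN hL => ?_⟩
    set p := 2 ^ k with hp
    have hkp : k + 1 ≤ p := Nat.lt_two_pow_self
    have hp1 : 1 ≤ p := Nat.one_le_two_pow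
    have hN1 : (1 : ℝ) ≤ N := by exact_mod_cast hN
    set s : ℕ → ℝ := fun h => ‖phaseSum (shiftDiff h f) (L - h)‖ with hs
    set W : ℝ := ∑ m ∈ Icc 1 (N ^ (k + 1)), (m.divisors.card : ℝ) ^ (k + 1) *
      weylMajorant N ((k + 1 + 1).factorial * m * f.coeff (k + 1 + 1)) with hW
    have hs0 : 0 ≤ ∑ h ∈ Icc 1 N, s h := Finset.sum_nonneg fun h _ => norm_nonneg _
    have h1 : ‖phaseSum f L‖ ^ 2 ^ (k + 1) ≤ 4 ^ p * ((N : ℝ) ^ p + (∑ h ∈ Icc 1 N, s h) ^ p) := by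
      rw [pow_succ 2 k, mul_comm, pow_mul]
      calc _ ≤ (N + 2 * ∑ h ∈ Icc 1 N, s h) ^ p := by
            gcongr
            exact norm_phaseSum_sq_le f hL
        _ ≤ (2 * (N + ∑ h ∈ Icc 1 N, s h)) ^ p := by
            gcongr
            linarith
        _ ≤ 2 ^ p * (2 ^ p * ((N : ℝ) ^ p + (∑ h ∈ Icc 1 N, s h) ^ p)) := by
            rw [mul_pow]
            gcongr
            refine (add_pow_le (by positivity) hs0 p).trans ?_
            gcongr
            · norm_num
            · omega
        _ = _ := by rw [← mul_assoc, ← mul_pow]; norm_num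
    have h2 : (∑ h ∈ Icc 1 N, s h) ^ p * N ≤ (N : ℝ) ^ p * ∑ h ∈ Icc 1 N, s h ^ p := by
      have h := pow_sum_div_card_le_sum_pow (s := Icc 1 N) (f := s) (fun h _ => norm_nonneg _) (p - 1)
      rw [Nat.sub_add_cancel hp1, Nat.card_Icc, Nat.add_sub_cancel, div_le_iff₀ (by positivity)] at h
      have h' := mul_le_mul_of_nonneg_right h (by positivity : (0 : ℝ) ≤ N)
      rw [mul_assoc, ← pow_succ, Nat.sub_add_cancel hp1] at h'
      linarith
    have h3 : ∀ h ∈ Icc 1 N, s h ^ p * (N : ℝ) ^ (k + 1) ≤ K * (N : ℝ) ^ p * ((N : ℝ) ^ k +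
        ∑ m ∈ Icc 1 (N ^ k), (m.divisors.card : ℝ) ^ k *
          weylMajorant N ((k + 1 + 1).factorial * (h * m : ℕ) * f.coeff (k + 1 + 1))) := by
      intro h _
      have := ih (shiftDiff h f) (L - h) N (natDegree_shiftDiff_le h (k + 1) hf) hN (by omega)
      rw [coeff_shiftDiff h (k + 1) hf] at this
      refine this.trans (le_of_eq ?_)
      congr 2
      refine Finset.sum_congr rfl fun m _ => ?_
      rw [Nat.factorial_succ (k + 1)]
      push_cast
      ring_nf
    have h4 : ∑ h ∈ Icc 1 N, ∑ m ∈ Icc 1 (N ^ k), (m.divisors.card : ℝ) ^ k *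
        weylMajorant N ((k + 1 + 1).factorial * (h * m : ℕ) * f.coeff (k + 1 + 1)) ≤ W := by
      have hr : W = ∑ n ∈ Icc 1 (N ^ (k + 1)), (n.divisors.card : ℝ) *
          ((n.divisors.card : ℝ) ^ k *
            weylMajorant N ((k + 1 + 1).factorial * n * f.coeff (k + 1 + 1))) :=
        Finset.sum_congr rfl fun n _ => by ring
      rw [hr, sum_card_divisors_mul (N ^ (k + 1)) fun n => (n.divisors.card : ℝ) ^ k *
            weylMajorant N ((k + 1 + 1).factorial * n * f.coeff (k + 1 + 1))]
      refine (Finset.sum_le_sum fun h hh => ?_).trans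
        (Finset.sum_le_sum_of_subset_of_nonneg
          (Icc_subset_Icc_right (Nat.le_self_pow (by omega) N)) fun h _ _ =>
            Finset.sum_nonneg fun m _ => mul_nonneg (by positivity) (weylMajorant_nonneg _ _))
      rw [mem_Icc] at hh
      refine (Finset.sum_le_sum fun m hm => ?_).trans
        (Finset.sum_le_sum_of_subset_of_nonneg (Icc_subset_Icc_right ?_) fun m _ _ =>
          mul_nonneg (by positivity) (weylMajorant_nonneg _ _))
      · rw [mem_Icc] at hm
        refine mul_le_mul_of_nonneg_right ?_ (weylMajorant_nonneg _ _)
        gcongr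
        · have := Nat.mul_pos hh.1 hm.1
          omega
        · exact dvd_mul_left m h
      · rw [Nat.le_div_iff_mul_le hh.1, pow_succ]
        exact Nat.mul_le_mul_left _ hh.2
    have h5 : (N : ℝ) ^ (k + 1) * ∑ h ∈ Icc 1 N, s h ^ p ≤
        K * (N : ℝ) ^ p * ((N : ℝ) ^ (k + 1) + W) := by
      rw [mul_comm, Finset.sum_mul]
      refine (Finset.sum_le_sum h3).trans ?_
      rw [← Finset.mul_sum, Finset.sum_add_distrib]
      simp only [sum_const, Nat.card_Icc, Nat.add_sub_cancel, nsmul_eq_mul]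
      rw [← pow_succ']
      gcongr
    have hW0 : 0 ≤ W :=
      Finset.sum_nonneg fun m _ => mul_nonneg (by positivity) (weylMajorant_nonneg _ _)
    have h6 : (N : ℝ) ^ p * (N : ℝ) ^ (k + 2) ≤ (N : ℝ) ^ (2 * p) * (N : ℝ) ^ (k + 1) := by
      rw [← pow_add, ← pow_add]
      exact pow_le_pow_right₀ hN1 (by omega)
    calc _ ≤ 4 ^ p * ((N : ℝ) ^ p + (∑ h ∈ Icc 1 N, s h) ^ p) * (N : ℝ) ^ (k + 2) := by gcongr
      _ = 4 ^ p * ((N : ℝ) ^ p * (N : ℝ) ^ (k + 2) +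
          ((∑ h ∈ Icc 1 N, s h) ^ p * N) * (N : ℝ) ^ (k + 1)) := by ring
      _ ≤ 4 ^ p * ((N : ℝ) ^ (2 * p) * (N : ℝ) ^ (k + 1) +
          ((N : ℝ) ^ p * ∑ h ∈ Icc 1 N, s h ^ p) * (N : ℝ) ^ (k + 1)) := by gcongr
      _ = 4 ^ p * ((N : ℝ) ^ (2 * p) * (N : ℝ) ^ (k + 1) +
          (N : ℝ) ^ p * ((N : ℝ) ^ (k + 1) * ∑ h ∈ Icc 1 N, s h ^ p)) := by ring
      _ ≤ 4 ^ p * ((N : ℝ) ^ (2 * p) * ((N : ℝ) ^ (k + 1) + W) +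
          (N : ℝ) ^ p * (K * (N : ℝ) ^ p * ((N : ℝ) ^ (k + 1) + W))) := by
          gcongr
          linarith
      _ = _ := by
          rw [pow_succ 2 k, ← hp, mul_comm p 2, two_mul, pow_add]
          ring

theorem sum_comp_natAbs_le {L M : ℕ} {j : ℕ → ℤ} (hinj : Set.InjOn j (range L))
    (hj : ∀ r ∈ range L, (j r).natAbs < M) {H : ℕ → ℝ} (hH : ∀ t, 0 ≤ H t) :
    ∑ r ∈ range L, H (j r).natAbs ≤ 2 * ∑ t ∈ range M, H t := by
  have key : ∀ P : ℕ → Prop, ∀ [DecidablePred P],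
      (∀ r s, P r → P s → (j r).natAbs = (j s).natAbs → j r = j s) →
      ∑ r ∈ (range L).filter P, H (j r).natAbs ≤ ∑ t ∈ range M, H t := by
    intro P _ hP
    rw [← Finset.sum_image (f := H) (g := fun r => (j r).natAbs)]
    · refine Finset.sum_le_sum_of_subset_of_nonneg ?_ fun t _ _ => hH t
      intro t ht
      obtain ⟨r, hr, rfl⟩ := mem_image.1 ht
      exact mem_range.2 (hj r (mem_filter.1 hr).1)
    · intro r hr s hs h
      have hr' := mem_filter.1 (mem_coe.1 hr)
      have hs' := mem_filter.1 (mem_coe.1 hs)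
      exact hinj (mem_coe.2 hr'.1) (mem_coe.2 hs'.1) (hP r s hr'.2 hs'.2 h)
  rw [← Finset.sum_filter_add_sum_filter_not (range L) (fun r => 0 ≤ j r), two_mul]
  exact add_le_add (key _ fun r s hr hs h => by omega) (key _ fun r s hr hs h => by omega)

theorem weylMajorant_le_of_natAbs_le (N q : ℕ) {θ : ℝ} {t : ℕ}
    (ht : (t : ℝ) ≤ q * |θ - round θ| + 2) :
    weylMajorant N θ ≤ if t < 3 then 2 * (N : ℝ) else 2 * q / ((t : ℝ) - 2) := by
  split_ifs with h
  · exact weylMajorant_le N θ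
  · have h3 : (3 : ℝ) ≤ t := by exact_mod_cast not_lt.1 h
    rw [weylMajorant, div_le_div_iff₀ (by positivity) (by linarith)]
    have hN : (0 : ℝ) ≤ N := Nat.cast_nonneg N
    have hq : (0 : ℝ) ≤ q := Nat.cast_nonneg q
    nlinarith

theorem sum_range_weylMajorant_block_le {α C : ℝ} {a q : ℕ} (hq : 0 < q) (haq : Nat.Coprime a q)
    (hC : 1 ≤ C) (hα : |α - (a : ℝ) / q| ≤ C / (q : ℝ) ^ 2) {L : ℕ} (hL : L * C ≤ q) (N : ℕ)
    (x : ℝ) :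
    ∑ r ∈ range L, weylMajorant N (x + r * α) ≤ 12 * N + 4 * q * (1 + Real.log q) := by
  have hq0 : (0 : ℝ) < q := by exact_mod_cast hq
  have hLq : L ≤ q := by
    have : (L : ℝ) ≤ q := (le_mul_of_one_le_right (Nat.cast_nonneg L) hC).trans hL
    exact_mod_cast this
  set j : ℕ → ℤ := fun r => ⌊x * q⌋ + r * a - q * round (x + r * α) with hj
  set H : ℕ → ℝ := fun t => if t < 3 then 2 * (N : ℝ) else 2 * q / ((t : ℝ) - 2) with hH
  have hH0 : ∀ t, 0 ≤ H t := by
    intro t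
    simp only [hH]
    split_ifs with h
    · positivity
    · have h3 : (3 : ℝ) ≤ t := by exact_mod_cast not_lt.1 h
      exact div_nonneg (by positivity) (by linarith)
  have hjb : ∀ r ∈ range L,
      ((j r).natAbs : ℝ) ≤ q * |x + r * α - round (x + r * α)| + 2 := by
    intro r hr
    have hrL : (r : ℝ) ≤ L := by exact_mod_cast (mem_range.1 hr).le
    have e : (j r : ℝ) = q * (x + r * α - round (x + r * α)) - Int.fract (x * q) -
        r * (q * (α - a / q)) := by
      simp only [hj, Int.fract]
      push_cast
      field_simp
      ring
    have h1 : |(r : ℝ) * (q * (α - a / q))| ≤ 1 := by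
      rw [abs_mul, abs_mul, Nat.abs_cast, Nat.abs_cast]
      calc (r : ℝ) * (q * |α - a / q|) ≤ L * (q * (C / (q : ℝ) ^ 2)) := by gcongr
        _ = (L * C) / q := by field_simp
        _ ≤ 1 := (div_le_one hq0).2 hL
    have h2 : |Int.fract (x * q)| ≤ 1 := by
      rw [abs_of_nonneg (Int.fract_nonneg _)]
      exact (Int.fract_lt_one _).le
    rw [Nat.cast_natAbs, Int.cast_abs, e]
    refine (abs_sub _ _).trans ?_
    have := abs_sub (q * (x + r * α - round (x + r * α))) (Int.fract (x * q))
    rw [abs_mul, Nat.abs_cast] at this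
    linarith
  have hjlt : ∀ r ∈ range L, (j r).natAbs < 3 + q := by
    intro r hr
    have h := hjb r hr
    have h2 := abs_sub_round (x + r * α)
    have : ((j r).natAbs : ℝ) < (3 + q : ℕ) := by
      push_cast
      nlinarith
    exact_mod_cast this
  have hinj : Set.InjOn j (range L) := by
    intro r hr s hs h
    simp only [coe_range, Set.mem_Iio] at hr hs
    simp only [hj] at h
    have hdvd : (q : ℤ) ∣ ((r : ℤ) - s) * a :=
      ⟨round (x + r * α) - round (x + s * α), by linarith⟩
    have hcop : IsCoprime (q : ℤ) (a : ℤ) := (Nat.isCoprime_iff_coprime.2 haq).symm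
    have h0 := Int.eq_zero_of_abs_lt_dvd (hcop.dvd_of_dvd_mul_right hdvd)
      (by rw [abs_lt]; omega)
    omega
  calc _ ≤ ∑ r ∈ range L, H (j r).natAbs :=
        Finset.sum_le_sum fun r hr => weylMajorant_le_of_natAbs_le N q (hjb r hr)
    _ ≤ 2 * ∑ t ∈ range (3 + q), H t := sum_comp_natAbs_le hinj hjlt hH0
    _ = 2 * (6 * N + 2 * q * ∑ i ∈ range q, ((i : ℝ) + 1)⁻¹) := by
        rw [Finset.sum_range_add, Finset.mul_sum]
        congr 2
        · simp [hH, Finset.sum_range_succ]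
          ring
        · refine Finset.sum_congr rfl fun i _ => ?_
          simp only [hH]
          rw [if_neg (by omega)]
          push_cast
          rw [show (3 : ℝ) + i - 2 = i + 1 by ring, div_eq_mul_inv]
    _ ≤ _ := by
        have h := harmonic_le_one_add_log q
        rw [harmonic] at h
        push_cast at h
        nlinarith

theorem sum_range_mul_le {F : ℕ → ℝ} {L : ℕ} {T : ℝ} (B : ℕ)
    (h : ∀ b, ∑ r ∈ range L, F (L * b + r) ≤ T) : ∑ m ∈ range (L * B), F m ≤ B * T := by
  induction B with
  | zero => simp
  | succ B ih =>
    rw [Nat.mul_succ, Finset.sum_range_add]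
    push_cast
    linarith [h B]

theorem sum_range_weylMajorant_le {α C : ℝ} {a q : ℕ} (hq : 0 < q) (haq : Nat.Coprime a q)
    (hC : 1 ≤ C) (hCq : C ≤ q) (hα : |α - (a : ℝ) / q| ≤ C / (q : ℝ) ^ 2) (N M : ℕ) :
    ∑ m ∈ range M, weylMajorant N (m * α) ≤
      (2 * C * M / q + 1) * (12 * N + 4 * q * (1 + Real.log q)) := by
  have hC0 : 0 < C := by linarith
  have hq0 : (0 : ℝ) < q := by exact_mod_cast hq
  set L := ⌊(q : ℝ) / C⌋₊ with hL
  have hqC : 1 ≤ (q : ℝ) / C := (one_le_div hC0).2 hCq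
  have hL1 : 1 ≤ L := Nat.one_le_floor_iff _ |>.2 hqC
  have hLC : L * C ≤ q := (le_div_iff₀ hC0).1 (Nat.floor_le (by positivity))
  have hL2 : (q : ℝ) ≤ 2 * C * L := by
    have h1 : (q : ℝ) / C < L + 1 := Nat.lt_floor_add_one _
    have h2 : (1 : ℝ) ≤ L := by exact_mod_cast hL1
    rw [div_lt_iff₀ hC0] at h1
    nlinarith
  have hT : 0 ≤ 12 * (N : ℝ) + 4 * q * (1 + Real.log q) := by
    have := Real.log_natCast_nonneg q
    positivity
  calc _ ≤ ∑ m ∈ range (L * (M / L + 1)), weylMajorant N (m * α) :=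
        Finset.sum_le_sum_of_subset_of_nonneg
          (range_subset_range.2 (Nat.lt_mul_div_succ M hL1).le)
          fun _ _ _ => weylMajorant_nonneg _ _
    _ ≤ (M / L + 1 : ℕ) * (12 * N + 4 * q * (1 + Real.log q)) := by
        refine sum_range_mul_le (F := fun m => weylMajorant N (m * α)) _ fun b => ?_
        refine le_trans (le_of_eq (Finset.sum_congr rfl fun r _ => ?_))
          (sum_range_weylMajorant_block_le hq haq hC hα hLC N ((L * b : ℕ) * α))
        push_cast
        ring_nf
    _ ≤ _ := by
        refine mul_le_mul_of_nonneg_right ?_ hT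
        push_cast
        refine add_le_add_left (Nat.cast_div_le.trans ?_) 1
        have : (0 : ℝ) < L := by exact_mod_cast hL1
        rw [div_le_div_iff₀ this hq0]
        nlinarith [(Nat.cast_nonneg M : (0 : ℝ) ≤ M)]

theorem coeff_taylor_of_natDegree_le (r : ℝ) {f : Polynomial ℝ} {n : ℕ} (hf : f.natDegree ≤ n) :
    (Polynomial.taylor r f).coeff n = f.coeff n := by
  have hc : (Polynomial.hasseDeriv n f).natDegree ≤ 0 :=
    (Polynomial.natDegree_hasseDeriv_le f n).trans (by omega)
  rw [Polynomial.taylor_coeff, Polynomial.eq_C_of_natDegree_le_zero hc, Polynomial.eval_C,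
    Polynomial.hasseDeriv_coeff]
  simp

theorem exists_phaseSum_eq (α : ℝ) (c : ℕ → ℝ) (k : ℕ) :
    ∃ f : Polynomial ℝ, f.natDegree ≤ k + 1 ∧ f.coeff (k + 1) = α ∧ ∀ N : ℕ,
      ∑ n ∈ Icc 1 N, eTwoPi (α * (n : ℝ) ^ (k + 1) + ∑ j ∈ Icc 1 k, c j * (n : ℝ) ^ j) =
        phaseSum f N := by
  set g : Polynomial ℝ := ∑ j ∈ Icc 1 k, Polynomial.C (c j) * Polynomial.X ^ j with hg
  set f : Polynomial ℝ := Polynomial.C α * Polynomial.X ^ (k + 1) + g with hf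
  have hgd : g.natDegree ≤ k := by
    refine Polynomial.natDegree_sum_le_of_forall_le _ _ fun j hj => ?_
    exact (Polynomial.natDegree_C_mul_X_pow_le _ _).trans (mem_Icc.1 hj).2
  have hfd : f.natDegree ≤ k + 1 :=
    Polynomial.natDegree_add_le_of_degree_le (Polynomial.natDegree_C_mul_X_pow_le _ _)
      (hgd.trans (Nat.le_succ k))
  refine ⟨Polynomial.taylor 1 f, by rwa [Polynomial.natDegree_taylor], ?_, fun N => ?_⟩
  · rw [coeff_taylor_of_natDegree_le 1 hfd, hf, Polynomial.coeff_add,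
      Polynomial.coeff_eq_zero_of_natDegree_lt (Nat.lt_succ_of_le hgd)]
    simp
  · rw [phaseSum, ← Finset.Ico_add_one_right_eq_Icc, Finset.sum_Ico_eq_sum_range,
      Nat.add_sub_cancel]
    refine Finset.sum_congr rfl fun n _ => ?_
    rw [Polynomial.taylor_eval, hf, hg, Polynomial.eval_add, Polynomial.eval_finsetSum]
    simp [add_comm]

theorem sum_card_divisors_pow_mul_weylMajorant_le (k N : ℕ) (α : ℝ) {Z : ℝ} (hZ : 0 < Z) :
    ∑ m ∈ Icc 1 (N ^ k), (m.divisors.card : ℝ) ^ k *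
        weylMajorant N ((k + 1).factorial * m * α) ≤
      Z * ∑ m ∈ range ((k + 1).factorial * N ^ k + 1), weylMajorant N (m * α) +
        2 * N / Z * ((N : ℝ) ^ k * (1 + k * Real.log N) ^ 2 ^ (2 * k)) := by
  have h1 : ∀ m ∈ Icc 1 (N ^ k),
      (m.divisors.card : ℝ) ^ k * weylMajorant N ((k + 1).factorial * m * α) ≤
        Z * weylMajorant N (((k + 1).factorial * m : ℕ) * α) +
          2 * N / Z * (m.divisors.card : ℝ) ^ (2 * k) := by
    intro m _
    have hG0 := weylMajorant_nonneg N ((k + 1).factorial * m * α)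
    have hG := weylMajorant_le N ((k + 1).factorial * m * α)
    set x : ℝ := (m.divisors.card : ℝ) ^ k with hx
    have hx0 : 0 ≤ x := by positivity
    have hxZ : x ≤ Z + x ^ 2 / Z := by
      rw [← sub_le_iff_le_add', le_div_iff₀ hZ]
      nlinarith [sq_nonneg (x - Z)]
    rw [mul_comm 2 k, pow_mul, ← hx]
    push_cast
    calc _ ≤ (Z + x ^ 2 / Z) * weylMajorant N ((k + 1).factorial * m * α) := by gcongr
      _ = Z * weylMajorant N ((k + 1).factorial * m * α) +
          x ^ 2 / Z * weylMajorant N ((k + 1).factorial * m * α) := by ring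
      _ ≤ Z * weylMajorant N ((k + 1).factorial * m * α) + x ^ 2 / Z * (2 * N) := by gcongr
      _ = _ := by ring
  refine (Finset.sum_le_sum h1).trans ?_
  rw [Finset.sum_add_distrib, ← Finset.mul_sum, ← Finset.mul_sum]
  have hF : 0 < (k + 1).factorial := Nat.factorial_pos _
  gcongr
  · rw [← Finset.sum_image (f := fun m : ℕ => weylMajorant N (m * α))
      (g := fun m => (k + 1).factorial * m)]
    · refine Finset.sum_le_sum_of_subset_of_nonneg ?_ fun _ _ _ => weylMajorant_nonneg _ _
      intro t ht
      obtain ⟨m, hm, rfl⟩ := mem_image.1 ht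
      exact mem_range.2 (Nat.lt_succ_of_le (Nat.mul_le_mul_left _ (mem_Icc.1 hm).2))
    · intro m _ n _ h
      exact Nat.eq_of_mul_eq_mul_left hF h
  · have := sum_card_divisors_pow_le (2 * k) (N ^ k)
    rwa [Nat.cast_pow, Real.log_pow] at this

theorem one_half_lt_log {x : ℝ} (hx : 2 ≤ x) : 1 / 2 < Real.log x := by
  have h1 := Real.log_two_gt_d9
  have h2 := Real.log_le_log two_pos hx
  linarith

set_option maxHeartbeats 400000 in
theorem norm_phaseSum_pow_le {k : ℕ} (hk : 1 ≤ k) :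
    ∃ K : ℝ, 0 < K ∧ ∀ (f : Polynomial ℝ) (a q N : ℕ) (C Z y : ℝ),
      f.natDegree ≤ k + 1 → 2 ≤ q → Nat.Coprime a q → 1 ≤ C → C ≤ q →
      |f.coeff (k + 1) - (a : ℝ) / q| ≤ C / (q : ℝ) ^ 2 → 1 < Z → 2 ≤ y → 1 ≤ N → (N : ℝ) ≤ y →
      ‖phaseSum f N‖ ^ 2 ^ k ≤ K * y ^ 2 ^ k * (C * Z / q + (C * Z / y) * Real.log q +
        C * Z * q * Real.log q / y ^ (k + 1) + Real.log y ^ 2 ^ (2 * k) / Z) := by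
  obtain ⟨K, hK, hW⟩ := weyl_differencing k
  set F := (k + 1).factorial with hF
  refine ⟨K * (48 * F + 26 + 2 * (k + 2) ^ 2 ^ (2 * k)), by positivity, ?_⟩
  intro f a q N C Z y hf hq haq hC hCq hα hZ hy hN hNy
  have hq0 : (0 : ℝ) < q := by exact_mod_cast (by omega : 0 < q)
  have hN1 : (1 : ℝ) ≤ N := by exact_mod_cast hN
  have hy0 : 0 < y := by linarith
  have hZ0 : 0 < Z := by linarith
  have hC0 : 0 < C := by linarith
  have hl := one_half_lt_log (x := q) (by exact_mod_cast hq)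
  have hly := one_half_lt_log hy
  have hF1 : (1 : ℝ) ≤ F := by exact_mod_cast Nat.factorial_pos (k + 1)
  have hyk : y ≤ y ^ k := le_self_pow₀ (by linarith) (by omega)
  have hNk : (N : ℝ) ^ k ≤ y ^ k := by gcongr
  set l := Real.log q with hl'
  set ly := Real.log y with hly'
  set c := 2 ^ (2 * k) with hc
  set E := C * Z / q + (C * Z / y) * l + C * Z * q * l / y ^ (k + 1) + ly ^ c / Z with hE
  set W := ∑ m ∈ Icc 1 (N ^ k), (m.divisors.card : ℝ) ^ k *
    weylMajorant N (F * m * f.coeff (k + 1)) with hWdef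
  have hE1 : y ^ (k + 1) * (C * Z / q) = C * Z * y ^ (k + 1) / q := by ring
  have hE2 : y ^ (k + 1) * ((C * Z / y) * l) = C * Z * l * y ^ k := by
    rw [pow_succ]
    field_simp
  have hE3 : y ^ (k + 1) * (C * Z * q * l / y ^ (k + 1)) = C * Z * q * l := by
    field_simp
  have hCZl : 1 / 2 ≤ C * Z * l := by
    have : 1 ≤ C * Z := one_le_mul_of_one_le_of_one_le hC hZ.le
    nlinarith
  have hWle : W ≤ Z * ((4 * C * F * y ^ k / q + 1) * (12 * y + 12 * q * l)) +
      2 * (k + 2) ^ c * (y ^ (k + 1) * (ly ^ c / Z)) := by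
    refine (sum_card_divisors_pow_mul_weylMajorant_le k N (f.coeff (k + 1)) hZ0).trans ?_
    refine add_le_add (mul_le_mul_of_nonneg_left ?_ hZ0.le) ?_
    · refine (sum_range_weylMajorant_le (by omega) haq hC hCq hα N _).trans ?_
      have h1 : 2 * C * ((F * N ^ k + 1 : ℕ) : ℝ) ≤ 4 * C * F * y ^ k := by
        push_cast
        have h2 : 1 ≤ F * y ^ k := one_le_mul_of_one_le_of_one_le hF1 (by linarith)
        have h3 : F * (N : ℝ) ^ k ≤ F * y ^ k := by gcongr
        nlinarith
      have h2 : 12 * (N : ℝ) + 4 * q * (1 + l) ≤ 12 * y + 12 * q * l := by nlinarith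
      have h3 : 0 ≤ 12 * (N : ℝ) + 4 * q * (1 + l) := by positivity
      exact mul_le_mul (by gcongr) h2 h3 (by positivity)
    · have hlogN : Real.log N ≤ ly := Real.log_le_log (by linarith) hNy
      have hlogN0 := Real.log_natCast_nonneg N
      calc _ ≤ 2 * y / Z * (y ^ k * ((k + 2) * ly) ^ c) := by
            gcongr
            nlinarith [(Nat.cast_nonneg k : (0 : ℝ) ≤ k)]
        _ = _ := by
            rw [mul_pow]
            ring
  have hW0 : 0 ≤ W :=
    Finset.sum_nonneg fun m _ => mul_nonneg (by positivity) (weylMajorant_nonneg _ _)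
  have hmain := hW f N N hf hN le_rfl
  rw [← hWdef] at hmain
  clear_value W F l ly c
  clear hW hα hWdef
  have hexp : Z * ((4 * C * F * y ^ k / q + 1) * (12 * y + 12 * q * l)) =
      48 * F * (C * Z * y ^ (k + 1) / q) + 48 * F * (C * Z * l * y ^ k) + 12 * (Z * y) +
        12 * (Z * q * l) := by
    field_simp
    ring
  have hZy : Z * y ≤ 2 * (C * Z * l * y ^ k) := by
    have h1 : Z * y ≤ Z * y ^ k := by gcongr
    have h2 : 1 / 2 ≤ C * l := by nlinarith
    have h3 : 0 ≤ Z * y ^ k := by positivity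
    linarith [mul_le_mul_of_nonneg_right h2 h3]
  have hZql : Z * q * l ≤ C * Z * q * l := by
    have : 0 ≤ Z * q * l := by positivity
    linarith [mul_le_mul_of_nonneg_right hC this]
  have hNk2 : (N : ℝ) ^ k ≤ 2 * (C * Z * l * y ^ k) := by
    have : 0 ≤ y ^ k := by positivity
    linarith [mul_le_mul_of_nonneg_right hCZl this]
  have hQ : (N : ℝ) ^ k + W ≤ (48 * F + 26 + 2 * (k + 2) ^ c) * y ^ (k + 1) * E := by
    have e1 : 0 ≤ C * Z * y ^ (k + 1) / q := by positivity
    have e2 : 0 ≤ C * Z * l * y ^ k := by positivity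
    have e3 : 0 ≤ C * Z * q * l := by positivity
    have e4 : 0 ≤ y ^ (k + 1) * (ly ^ c / Z) := by positivity
    have e5 : (0 : ℝ) ≤ (k + 2) ^ c := by positivity
    have hsplit : y ^ (k + 1) * E = C * Z * y ^ (k + 1) / q + C * Z * l * y ^ k +
        C * Z * q * l + y ^ (k + 1) * (ly ^ c / Z) := by
      rw [hE, mul_add, mul_add, mul_add, hE1, hE2, hE3]
    rw [mul_assoc, hsplit]
    rw [hexp] at hWle
    have p1 := mul_nonneg e5 e1
    have p2 := mul_nonneg e5 e2
    have p3 := mul_nonneg e5 e3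
    have p4 : 0 ≤ (F : ℝ) * (C * Z * q * l) := by positivity
    have p5 : 0 ≤ (F : ℝ) * (y ^ (k + 1) * (ly ^ c / Z)) := by positivity
    linarith
  clear_value E
  have hp : k + 1 ≤ 2 ^ k := Nat.lt_two_pow_self
  obtain ⟨e, he⟩ := Nat.exists_eq_add_of_le' hp
  have hNpos : (0 : ℝ) < (N : ℝ) ^ (k + 1) := by positivity
  have hdiv : ‖phaseSum f N‖ ^ 2 ^ k ≤ K * (N : ℝ) ^ e * ((N : ℝ) ^ k + W) := by
    refine le_of_mul_le_mul_right (hmain.trans (le_of_eq ?_)) hNpos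
    rw [show (N : ℝ) ^ 2 ^ k = (N : ℝ) ^ e * (N : ℝ) ^ (k + 1) by rw [he, pow_add]]
    ring
  calc _ ≤ K * (N : ℝ) ^ e * ((N : ℝ) ^ k + W) := hdiv
    _ ≤ K * y ^ e * ((48 * F + 26 + 2 * (k + 2) ^ c) * y ^ (k + 1) * E) := by gcongr
    _ = _ := by
        rw [show y ^ 2 ^ k = y ^ e * y ^ (k + 1) by rw [he, pow_add]]
        ring

/-- Lemma 3.5 (refined Weyl inequality): for `d ≥ 2`,
`U(n) = α n^d + α_{d-1}n^{d-1} + ⋯ + α₁ n`, `|α - a/q| ≤ C/q²` with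
`1 ≤ a < q`, `(a,q)=1`, `C ≥ 1`, and `κ = 2^{1-d}`, there are constants
`A = A(d)` and `K = K(d)` such that for all `Z > 1`, `y > 1`:
`|∑_{n ≤ y} e(U(n))| ≤ K y (CZ/q + (CZ/y) log q + CZ q log q / y^d + log^A y / Z)^κ`. -/
theorem stmt12 (d : ℕ) (hd : 2 ≤ d) :
    ∃ A K : ℝ, 0 < K ∧
      ∀ (α : ℝ) (c : ℕ → ℝ) (a q : ℕ) (C Z y : ℝ),
        1 ≤ a → a < q → Nat.Coprime a q → 1 ≤ C →
        |α - (a : ℝ) / q| ≤ C / (q : ℝ) ^ 2 → 1 < Z → 1 < y →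
        ‖∑ n ∈ Finset.Icc 1 ⌊y⌋₊,
            eTwoPi (α * (n : ℝ) ^ d + ∑ j ∈ Finset.Icc 1 (d - 1), c j * (n : ℝ) ^ j)‖ ≤
          K * y * (C * Z / q + (C * Z / y) * Real.log q +
              C * Z * q * Real.log q / y ^ d +
              Real.log y ^ A / Z) ^ ((1 / 2 : ℝ) ^ (d - 1)) := by
  obtain ⟨k, rfl⟩ : ∃ k, d = k + 1 := ⟨d - 1, by omega⟩
  rw [Nat.add_sub_cancel]
  obtain ⟨K, hK, hbound⟩ := norm_phaseSum_pow_le (k := k) (by omega)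
  refine ⟨(2 ^ (2 * k) : ℕ), K + 3, by positivity, ?_⟩
  intro α c a q C Z y ha haq hcop hC hα hZ hy
  obtain ⟨f, hfd, hfc, hfS⟩ := exists_phaseSum_eq α c k
  rw [hfS, Real.rpow_natCast]
  have hy0 : 0 < y := by linarith
  have hZ0 : 0 < Z := by linarith
  have hC0 : 0 < C := by linarith
  have hq0 : (0 : ℝ) < q := by exact_mod_cast (by omega : 0 < q)
  have hq2 : (2 : ℝ) ≤ q := by exact_mod_cast (by omega : 2 ≤ q)
  have hl0 : 0 < Real.log q := Real.log_pos (by linarith)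
  have hly0 : 0 < Real.log y := Real.log_pos hy
  have hNy : (⌊y⌋₊ : ℝ) ≤ y := Nat.floor_le hy0.le
  have e1 : 0 < C * Z / q := by positivity
  have e2 : 0 < C * Z / y * Real.log q := by positivity
  have e3 : 0 < C * Z * q * Real.log q / y ^ (k + 1) := by positivity
  have e4 : 0 < Real.log y ^ 2 ^ (2 * k) / Z := by positivity
  have hCZ : 1 ≤ C * Z := one_le_mul_of_one_le_of_one_le hC hZ.le
  set E := C * Z / q + C * Z / y * Real.log q + C * Z * q * Real.log q / y ^ (k + 1) +
    Real.log y ^ 2 ^ (2 * k) / Z with hE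
  have hE0 : 0 < E := by positivity
  have key : ‖phaseSum f ⌊y⌋₊‖ ^ 2 ^ k ≤ (K + 3) * y ^ 2 ^ k * E := by
    have hyp : 0 < y ^ 2 ^ k := by positivity
    have trivial_bound (h : 1 / 3 ≤ E) : ‖phaseSum f ⌊y⌋₊‖ ^ 2 ^ k ≤ (K + 3) * y ^ 2 ^ k * E := by
      calc ‖phaseSum f ⌊y⌋₊‖ ^ 2 ^ k ≤ y ^ 2 ^ k := by
            gcongr
            exact (norm_phaseSum_le f _).trans hNy
        _ = y ^ 2 ^ k * 1 := (mul_one _).symm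
        _ ≤ y ^ 2 ^ k * ((K + 3) * E) := by
            gcongr
            nlinarith
        _ = _ := by ring
    rcases lt_or_ge y 2 with hy2 | hy2
    · refine trivial_bound ?_
      have h1 := Real.log_two_gt_d9
      have h2 := Real.log_le_log two_pos hq2
      have h3 : 1 / 2 ≤ C * Z / y := by
        rw [div_le_div_iff₀ two_pos hy0]
        linarith
      have h4 : 1 / 3 ≤ C * Z / y * Real.log q := by nlinarith
      linarith
    rcases lt_or_ge (q : ℝ) C with hqC | hCq
    · refine trivial_bound ?_
      have : 1 ≤ C * Z / q := by
        rw [le_div_iff₀ hq0]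
        nlinarith
      linarith
    · have h := hbound f a q ⌊y⌋₊ C Z y hfd (by omega) hcop hC hCq (hfc ▸ hα) hZ hy2
        (Nat.one_le_floor_iff _ |>.2 hy.le) hNy
      refine h.trans ?_
      gcongr
      linarith
  have hroot : (E ^ ((1 / 2 : ℝ) ^ k)) ^ 2 ^ k = E := by
    rw [← Real.rpow_natCast, ← Real.rpow_mul hE0.le]
    push_cast
    rw [← mul_pow]
    norm_num
  refine le_of_pow_le_pow_left₀ (n := 2 ^ k) (by positivity) (by positivity) ?_
  rw [mul_pow, mul_pow, hroot]
  refine key.trans ?_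
  gcongr
  exact le_self_pow₀ (by linarith) (by positivity)
end

section
/- Extended Bourgain–Sarnak–Ziegler theorem (qualitative core): Let x be large, log^δ x < H < K < x^δ with 0 < δ ≤ 1/10. Let a be multiplicative with |a(p)| ≤ A for all primes p, and φ with |φ(n)| ≤ 1. Assume (a) for every interval of primes 𝒫 = {z < p ≤ w} with H²/2 ≤ z < w ≤ 2K², every squarefree P̄ ∈ {1, ∏_{p∈𝒫} p}, and every y ≥ c·x/w: ∑_{n ≤ y, gcd(n,P̄)=1} |a(n)|² ≤ C y ∏_{p | P̄}(1 - 1/p); and (b) whenever w - z ≍ √z and y ≍ x/z: ∑_{p ≠ q ∈ 𝒫} |∑_{m ≤ y} φ(pm) conj(φ(qm))| ≤ C τ z y / log² z, for some τ = τ(x) ≤ 1. Then ∑_{n ≤ x} a(n) φ(n) ≪ x (1/√(H log H) + √τ + log H / log K), with implied constant depending only on A, C, δ. -/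
open Finset Complex

/-- The finite set of primes `p` with `z < p ≤ w`. -/
noncomputable def primesIn (z w : ℝ) : Finset ℕ :=
  (Finset.Icc 1 ⌊w⌋₊).filter fun p => p.Prime ∧ z < (p : ℝ) ∧ (p : ℝ) ≤ w

/-- The primes `p` with `m < p ≤ n`. -/
def primesIoc (m n : ℕ) : Finset ℕ := (Ioc m n).filter Nat.Prime

lemma mem_primesIoc {m n p : ℕ} : p ∈ primesIoc m n ↔ (m < p ∧ p ≤ n) ∧ p.Prime := by
  simp [primesIoc]

lemma primesIn_natCast (m n : ℕ) : primesIn m n = primesIoc m n := by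
  ext p
  simp only [primesIn, mem_primesIoc, mem_filter, mem_Icc, Nat.floor_natCast, Nat.cast_lt,
    Nat.cast_le]
  constructor
  · rintro ⟨-, h, h1, h2⟩
    exact ⟨⟨h1, h2⟩, h⟩
  · rintro ⟨⟨h1, h2⟩, h⟩
    exact ⟨⟨h.one_lt.le, h2⟩, h, h1, h2⟩

lemma rpow_neg_one_add_le {s : ℝ} (hs : 0 < s) {n : ℕ} (hn : 1 ≤ n) :
    ((n + 1 : ℕ) : ℝ) ^ (-(1 + s)) ≤
      1 / s * (n : ℝ) ^ (-s) - 1 / s * ((n + 1 : ℕ) : ℝ) ^ (-s) := by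
  have hn' : (0 : ℝ) < n := by exact_mod_cast hn
  have hm : (0 : ℝ) < ((n + 1 : ℕ) : ℝ) := by positivity
  set m : ℝ := ((n + 1 : ℕ) : ℝ) with hmdef
  have hmn : m = n + 1 := by simp [hmdef]
  have h1 : (n : ℝ) ^ (-s) = m ^ (-s) * ((n : ℝ) / m) ^ (-s) := by
    rw [← Real.mul_rpow hm.le (by positivity)]
    congr 1
    field_simp
  have h2 : 1 + s / m ≤ ((n : ℝ) / m) ^ (-s) := by
    rw [Real.rpow_def_of_pos (by positivity)]
    have h3 := Real.add_one_le_exp (Real.log ((n : ℝ) / m) * -s)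
    have h4 := Real.log_le_sub_one_of_pos (show 0 < (n : ℝ) / m by positivity)
    have h5 : (n : ℝ) / m - 1 = -(1 / m) := by
      rw [hmn]; field_simp; ring
    rw [h5] at h4
    have h6 : s / m = s * (1 / m) := by ring
    rw [h6]
    nlinarith
  have h7 : m ^ (-(1 + s)) = m ^ (-s) * (1 / m) := by
    rw [show -(1 + s) = -s + -1 by ring, Real.rpow_add hm, Real.rpow_neg_one, one_div]
  rw [h1, h7]
  have h8 : 0 ≤ m ^ (-s) := by positivity
  have h9 := mul_le_mul_of_nonneg_left h2 h8
  have : m ^ (-s) * (1 / m) = 1 / s * (m ^ (-s) * (1 + s / m)) - 1 / s * m ^ (-s) := by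
    field_simp; ring
  rw [this]
  gcongr

lemma sum_rpow_neg_one_add_le {s : ℝ} (hs : 0 < s) {S : Finset ℕ} (hS : ∀ n ∈ S, n ≠ 0) :
    ∑ n ∈ S, (n : ℝ) ^ (-(1 + s)) ≤ 1 + 1 / s := by
  have key : ∀ N : ℕ, 1 ≤ N →
      ∑ n ∈ Icc 1 N, (n : ℝ) ^ (-(1 + s)) ≤ 1 + 1 / s - 1 / s * (N : ℝ) ^ (-s) := by
    intro N hN
    induction N, hN using Nat.le_induction with
    | base => simp
    | succ n hn ih =>
      rw [Finset.sum_Icc_succ_top (by omega)]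
      have := rpow_neg_one_add_le hs hn
      linarith
  have hsub : S ⊆ Icc 1 (S.sup id + 1) := by
    intro n hn
    have : n ≤ S.sup id := Finset.le_sup (f := id) hn
    have := hS n hn
    simp only [mem_Icc]
    omega
  calc _ ≤ ∑ n ∈ Icc 1 (S.sup id + 1), (n : ℝ) ^ (-(1 + s)) :=
        sum_le_sum_of_subset_of_nonneg hsub fun _ _ _ => by positivity
    _ ≤ _ := key _ (by omega)
    _ ≤ _ := by
      have : 0 ≤ 1 / s * ((S.sup id + 1 : ℕ) : ℝ) ^ (-s) := by positivity
      linarith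

/-- The completely multiplicative function `n ↦ n ^ (-σ)`. -/
noncomputable def rpowNegHom (σ : ℝ) : ℕ →* ℝ where
  toFun n := (n : ℝ) ^ (-σ)
  map_one' := by simp
  map_mul' m n := by push_cast; rw [Real.mul_rpow (by positivity) (by positivity)]

lemma rpow_neg_prime_lt_one {σ : ℝ} (hσ : 0 < σ) {p : ℕ} (hp : p.Prime) :
    (p : ℝ) ^ (-σ) < 1 :=
  Real.rpow_lt_one_of_one_lt_of_neg (by exact_mod_cast hp.one_lt) (by linarith)

lemma hasSum_factoredNumbers_rpow {σ : ℝ} (hσ : 0 < σ) {Q : Finset ℕ}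
    (hQ : ∀ p ∈ Q, p.Prime) :
    HasSum (fun m : Nat.factoredNumbers Q => (m : ℝ) ^ (-σ))
      (∏ p ∈ Q, (1 - (p : ℝ) ^ (-σ))⁻¹) := by
  have h := (EulerProduct.summable_and_hasSum_factoredNumbers_prod_filter_prime_geometric
    (f := rpowNegHom σ) (fun {p} hp => by
      change ‖(p : ℝ) ^ (-σ)‖ < 1
      rw [Real.norm_of_nonneg (by positivity)]
      exact rpow_neg_prime_lt_one hσ hp) Q).2
  rw [filter_true_of_mem hQ] at h
  exact h

lemma sum_inv_le_prod_euler {Q S : Finset ℕ} (hQ : ∀ p ∈ Q, p.Prime)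
    (hS : ∀ n ∈ S, n ≠ 0 ∧ ∀ p : ℕ, p.Prime → p ∣ n → p ∈ Q) :
    ∑ n ∈ S, 1 / (n : ℝ) ≤ ∏ p ∈ Q, (1 - 1 / (p : ℝ))⁻¹ := by
  classical
  have h := hasSum_factoredNumbers_rpow one_pos hQ
  have hS' : ∀ n ∈ S, n ∈ Nat.factoredNumbers Q := fun n hn =>
    Nat.mem_factoredNumbers'.2 fun p hp hpn => (hS n hn).2 p hp hpn
  have h2 := sum_le_hasSum (S.subtype (· ∈ Nat.factoredNumbers Q)) (fun _ _ => by positivity) h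
  rw [sum_subtype_of_mem (fun n : ℕ => (n : ℝ) ^ (-1 : ℝ)) hS'] at h2
  simpa [Real.rpow_neg_one] using h2

lemma prod_euler_le {s : ℝ} (hs : 0 < s) {Q : Finset ℕ} (hQ : ∀ p ∈ Q, p.Prime) :
    ∏ p ∈ Q, (1 - (p : ℝ) ^ (-(1 + s)))⁻¹ ≤ 1 + 1 / s := by
  refine hasSum_le_of_sum_le (hasSum_factoredNumbers_rpow (by linarith) hQ) fun T => ?_
  have := sum_rpow_neg_one_add_le hs (S := T.map (Function.Embedding.subtype _)) (by
    intro n hn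
    obtain ⟨m, -, rfl⟩ := mem_map.1 hn
    exact Nat.ne_zero_of_mem_factoredNumbers m.2)
  simpa using this

lemma sum_log_primeFactors_le {n : ℕ} (hn : n ≠ 0) :
    ∑ p ∈ n.primeFactors, Real.log p ≤ Real.log n := by
  rw [← Real.log_prod (fun p hp => by exact_mod_cast (Nat.prime_of_mem_primeFactors hp).ne_zero)]
  apply Real.log_le_log
  · exact prod_pos fun p hp => by exact_mod_cast (Nat.prime_of_mem_primeFactors hp).pos
  · rw [← Nat.cast_prod]
    exact_mod_cast Nat.le_of_dvd (Nat.pos_of_ne_zero hn) (Nat.prod_primeFactors_dvd n)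

lemma sum_log_div_le {N : ℕ} (hN : 1 ≤ N) :
    ∑ p ∈ primesIoc 0 N, Real.log p / p ≤ 2 * Real.log N := by
  have hN' : (0 : ℝ) < N := by exact_mod_cast hN
  have h1 : ∑ n ∈ Ioc 0 N, ∑ p ∈ n.primeFactors, Real.log p ≤ N * Real.log N := by
    calc _ ≤ ∑ n ∈ Ioc 0 N, Real.log N := by
          refine sum_le_sum fun n hn => ?_
          rw [mem_Ioc] at hn
          refine (sum_log_primeFactors_le (by omega)).trans ?_
          exact Real.log_le_log (by exact_mod_cast hn.1) (by exact_mod_cast hn.2)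
      _ = _ := by simp
  have h2 : ∑ n ∈ Ioc 0 N, ∑ p ∈ n.primeFactors, Real.log p =
      ∑ p ∈ primesIoc 0 N, ∑ n ∈ (Ioc 0 N).filter (p ∣ ·), Real.log p := by
    refine sum_comm' fun n p => ?_
    simp only [mem_Ioc, Nat.mem_primeFactors, mem_primesIoc, mem_filter]
    constructor
    · rintro ⟨⟨h0, h1⟩, h2, h3, -⟩
      exact ⟨⟨⟨h0, h1⟩, h3⟩, ⟨h2.pos, (Nat.le_of_dvd h0 h3).trans h1⟩, h2⟩
    · rintro ⟨⟨⟨h0, h1⟩, h3⟩, -, h2⟩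
      exact ⟨⟨h0, h1⟩, h2, h3, h0.ne'⟩
  rw [h2] at h1
  have h3 : ∑ p ∈ primesIoc 0 N, (N : ℝ) / 2 * (Real.log p / p) ≤ N * Real.log N := by
    refine le_trans (sum_le_sum fun p hp => ?_) h1
    rw [mem_primesIoc] at hp
    have hp0 : 0 < p := hp.1.1
    have hp0' : (0 : ℝ) < p := by exact_mod_cast hp0
    rw [sum_const, Nat.Ioc_filter_dvd_card_eq_div, nsmul_eq_mul]
    have hlog : 0 ≤ Real.log p := Real.log_natCast_nonneg p
    have hd : N ≤ 2 * (N / p) * p := by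
      have h4 := Nat.div_add_mod N p
      have h5 := Nat.mod_lt N hp0
      have h6 : 1 ≤ N / p := Nat.div_pos hp.1.2 hp0
      nlinarith
    have hd' : (N : ℝ) ≤ 2 * ((N / p : ℕ) : ℝ) * p := by exact_mod_cast hd
    have : (N : ℝ) / 2 * (Real.log p / p) = (N / (2 * p)) * Real.log p := by field_simp
    rw [this]
    refine mul_le_mul_of_nonneg_right ?_ hlog
    rw [div_le_iff₀ (by positivity)]
    linarith
  rw [← mul_sum] at h3
  have : (N : ℝ) * (∑ p ∈ primesIoc 0 N, Real.log p / p) ≤ N * (2 * Real.log N) := by linarith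
  exact le_of_mul_le_mul_left this hN'

lemma inv_one_sub_inv_prime_le {s : ℝ} (hs : 0 < s) {p : ℕ} (hp : p.Prime) :
    (1 - 1 / (p : ℝ))⁻¹ ≤
      (1 - (p : ℝ) ^ (-(1 + s)))⁻¹ * Real.exp (2 * s * (Real.log p / p)) := by
  have hp2 : (2 : ℝ) ≤ p := by exact_mod_cast hp.two_le
  have hp0 : (0 : ℝ) < p := by linarith
  have h1 : 1 / (p : ℝ) ≤ 1 / 2 := by gcongr
  have h2 := rpow_neg_prime_lt_one (σ := 1 + s) (by linarith) hp
  have h3 : (p : ℝ) ^ (-(1 + s)) = 1 / p * (p : ℝ) ^ (-s) := by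
    rw [show -(1 + s) = -1 + -s by ring, Real.rpow_add hp0, Real.rpow_neg_one, one_div]
  have h4 : 1 - s * Real.log p ≤ (p : ℝ) ^ (-s) := by
    rw [Real.rpow_def_of_pos hp0]
    have := Real.add_one_le_exp (Real.log p * -s)
    linarith
  have h5 := Real.add_one_le_exp (2 * s * (Real.log p / p))
  have hlog : 0 ≤ Real.log p := Real.log_natCast_nonneg p
  rw [← div_eq_inv_mul, le_div_iff₀ (by linarith), inv_mul_le_iff₀ (by linarith)]
  have h6 : 2 * s * (Real.log p / p) = 2 * (1 / p * (s * Real.log p)) := by ring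
  rw [h6] at h5 ⊢
  set t := 1 / (p : ℝ) * (s * Real.log p) with ht
  have ht0 : 0 ≤ t := by positivity
  have h7 : 1 / (p : ℝ) - t ≤ (p : ℝ) ^ (-(1 + s)) := by
    rw [h3, ht]
    have : 0 ≤ 1 / (p : ℝ) := by positivity
    nlinarith
  nlinarith

lemma one_sub_inv_prime_pos {p : ℕ} (hp : p.Prime) : 0 < 1 - 1 / (p : ℝ) := by
  have hp2 : (2 : ℝ) ≤ p := by exact_mod_cast hp.two_le
  have h1 : 1 / (p : ℝ) ≤ 1 / 2 := by gcongr
  linarith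

lemma log_two_gt_half : (1 / 2 : ℝ) < Real.log 2 := by
  have := Real.log_two_gt_d9
  norm_num at this ⊢
  linarith

lemma half_le_log_natCast {N : ℕ} (hN : 2 ≤ N) : 1 / 2 ≤ Real.log N :=
  log_two_gt_half.le.trans (Real.log_le_log (by norm_num) (by exact_mod_cast hN))

lemma primesIoc_prime {m n : ℕ} : ∀ p ∈ primesIoc m n, p.Prime :=
  fun _ hp => (mem_primesIoc.1 hp).2

/-- The constant in the upper bound of Mertens' third theorem. -/
noncomputable def mertensConst : ℝ := 3 * Real.exp 4

lemma mertensConst_pos : 0 < mertensConst := by unfold mertensConst; positivity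

/-- The upper bound in Mertens' third theorem. -/
lemma prod_inv_one_sub_inv_le {N : ℕ} (hN : 2 ≤ N) :
    ∏ p ∈ primesIoc 0 N, (1 - 1 / (p : ℝ))⁻¹ ≤ mertensConst * Real.log N := by
  have hL := half_le_log_natCast hN
  set L := Real.log N with hLdef
  have hs : 0 < 1 / L := by positivity
  calc _ ≤ ∏ p ∈ primesIoc 0 N, ((1 - (p : ℝ) ^ (-(1 + 1 / L)))⁻¹ *
        Real.exp (2 * (1 / L) * (Real.log p / p))) :=
        prod_le_prod (fun p hp => (inv_pos.2 (one_sub_inv_prime_pos (primesIoc_prime p hp))).le)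
          fun p hp => inv_one_sub_inv_prime_le hs (primesIoc_prime p hp)
    _ = (∏ p ∈ primesIoc 0 N, (1 - (p : ℝ) ^ (-(1 + 1 / L)))⁻¹) *
        Real.exp (2 * (1 / L) * ∑ p ∈ primesIoc 0 N, Real.log p / p) := by
        rw [prod_mul_distrib, mul_sum, Real.exp_sum]
    _ ≤ (1 + 1 / (1 / L)) * Real.exp (2 * (1 / L) * (2 * L)) := by
        gcongr
        · exact prod_euler_le hs primesIoc_prime
        · exact sum_log_div_le (by omega)
    _ = (1 + L) * Real.exp 4 := by
        rw [one_div_one_div]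
        congr 2
        field_simp
        norm_num
    _ ≤ _ := by
        unfold mertensConst
        have := Real.exp_pos 4
        nlinarith

lemma log_le_prod_inv_one_sub_inv (N : ℕ) :
    Real.log (N + 1) ≤ ∏ p ∈ primesIoc 0 N, (1 - 1 / (p : ℝ))⁻¹ := by
  have h := log_add_one_le_harmonic N
  rw [harmonic_eq_sum_Icc] at h
  push_cast at h
  refine h.trans ?_
  simp only [← one_div]
  have := sum_inv_le_prod_euler (Q := primesIoc 0 N) (S := Icc 1 N) primesIoc_prime (by
    intro n hn
    rw [mem_Icc] at hn
    exact ⟨by omega, fun p hp hpn => mem_primesIoc.2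
      ⟨⟨hp.pos, (Nat.le_of_dvd (by omega) hpn).trans hn.2⟩, hp⟩⟩)
  simpa only [one_div] using this

lemma primesIoc_union {l m n : ℕ} (hlm : l ≤ m) (hmn : m ≤ n) :
    primesIoc l n = primesIoc l m ∪ primesIoc m n := by
  rw [primesIoc, ← Ioc_union_Ioc_eq_Ioc hlm hmn, filter_union]
  rfl

lemma disjoint_primesIoc (l m n : ℕ) : Disjoint (primesIoc l m) (primesIoc m n) := by
  rw [disjoint_left]
  intro p hp hp'
  rw [mem_primesIoc] at hp hp'
  omega

lemma prod_one_sub_inv_le {z w : ℕ} (hz : 2 ≤ z) (hzw : z ≤ w) :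
    ∏ p ∈ primesIoc z w, (1 - 1 / (p : ℝ)) ≤ mertensConst * (Real.log z / Real.log w) := by
  have h1 := log_le_prod_inv_one_sub_inv w
  have h2 := prod_inv_one_sub_inv_le hz
  have hw := half_le_log_natCast (hz.trans hzw)
  have h3 : Real.log w ≤ Real.log (w + 1) :=
    Real.log_le_log (by exact_mod_cast (by omega : 0 < w)) (by linarith)
  rw [primesIoc_union (Nat.zero_le z) hzw, prod_union (disjoint_primesIoc 0 z w)] at h1
  have hpos : 0 < ∏ p ∈ primesIoc z w, (1 - 1 / (p : ℝ)) :=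
    prod_pos fun p hp => one_sub_inv_prime_pos (primesIoc_prime p hp)
  rw [prod_inv_distrib (s := primesIoc z w)] at h1
  rw [mul_div_assoc', le_div_iff₀ (by linarith)]
  set P := ∏ p ∈ primesIoc z w, (1 - 1 / (p : ℝ))
  calc P * Real.log w ≤ P * ((∏ p ∈ primesIoc 0 z, (1 - 1 / (p : ℝ))⁻¹) * P⁻¹) := by
        gcongr
        exact h3.trans h1
    _ = ∏ p ∈ primesIoc 0 z, (1 - 1 / (p : ℝ))⁻¹ := by field_simp
    _ ≤ _ := h2

/-- A divisor-closed set of integers up to `N` has few elements if its sum of reciprocals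
is small. -/
lemma card_mul_log_le {N : ℕ} {S : Finset ℕ} (hS : ∀ n ∈ S, 0 < n ∧ n ≤ N)
    (hdiv : ∀ n ∈ S, ∀ d, d ∣ n → d ∈ S) :
    (S.card : ℝ) * Real.log N ≤ 7 * N * ∑ n ∈ S, 1 / (n : ℝ) := by
  have h1 : ∑ n ∈ S, Real.log n ≤ ∑ m ∈ S, Chebyshev.psi ((N : ℝ) / m) := by
    calc ∑ n ∈ S, Real.log n
        = ∑ n ∈ S, ∑ m ∈ n.divisors, ArithmeticFunction.vonMangoldt (n / m) := by
          refine sum_congr rfl fun n _ => ?_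
          rw [Nat.sum_div_divisors, ArithmeticFunction.vonMangoldt_sum]
      _ = ∑ m ∈ S, ∑ n ∈ S.filter (m ∣ ·), ArithmeticFunction.vonMangoldt (n / m) := by
          refine sum_comm' fun n m => ?_
          simp only [Nat.mem_divisors, mem_filter]
          constructor
          · rintro ⟨h, h1, h2⟩
            exact ⟨⟨h, h1⟩, hdiv n h m h1⟩
          · rintro ⟨⟨h, h1⟩, h2⟩
            exact ⟨h, h1, (hS n h).1.ne'⟩
      _ ≤ _ := by
          refine sum_le_sum fun m hm => ?_
          have hm0 := (hS m hm).1
          rw [Chebyshev.psi, ← sum_image (f := fun d => ArithmeticFunction.vonMangoldt d)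
            (g := fun n => n / m) (s := S.filter (m ∣ ·))]
          · refine sum_le_sum_of_subset_of_nonneg ?_ fun _ _ _ =>
              ArithmeticFunction.vonMangoldt_nonneg
            intro d hd
            obtain ⟨n, hn, rfl⟩ := mem_image.1 hd
            rw [mem_filter] at hn
            have hn' := hS n hn.1
            rw [mem_Ioc, Nat.floor_div_natCast, Nat.floor_natCast]
            exact ⟨Nat.div_pos (Nat.le_of_dvd hn'.1 hn.2) hm0, Nat.div_le_div_right hn'.2⟩
          · intro x hx y hy hxy
            simp only [coe_filter, Set.mem_ofPred_eq] at hx hy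
            exact (Nat.div_left_inj hx.2 hy.2).1 hxy
  have h2 : ∀ n ∈ S, Real.log N - Real.log n ≤ N * (1 / (n : ℝ)) := by
    intro n hn
    have hn0 : (0 : ℝ) < n := by exact_mod_cast (hS n hn).1
    have hN0 : (0 : ℝ) < N := lt_of_lt_of_le hn0 (by exact_mod_cast (hS n hn).2)
    rw [← Real.log_div hN0.ne' hn0.ne', mul_one_div]
    have := Real.log_le_sub_one_of_pos (div_pos hN0 hn0)
    linarith
  have h3 : ∀ n ∈ S, Chebyshev.psi ((N : ℝ) / n) ≤ 6 * (N * (1 / (n : ℝ))) := by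
    intro n _
    have := Chebyshev.psi_le_const_mul_self (x := (N : ℝ) / n) (by positivity)
    have h4 : Real.log 4 ≤ 2 := by
      rw [show (4 : ℝ) = 2 ^ 2 by norm_num, Real.log_pow]
      have := Real.log_two_lt_d9
      norm_num at this ⊢
      linarith
    rw [mul_one_div]
    refine this.trans ?_
    gcongr
    linarith
  have h4 := sum_le_sum h2
  have h5 := sum_le_sum h3
  rw [sum_sub_distrib, sum_const, nsmul_eq_mul, ← mul_sum] at h4
  rw [← mul_sum, ← mul_sum] at h5
  linarith

/-- Sieve upper bound for the integers without prime factors in `(z, w]`. -/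
lemma card_sifted_le {z w N : ℕ} (hz : 2 ≤ z) (hzw : z ≤ w) (hwN : w ≤ N) :
    ((((Icc 1 N).filter fun n => ∀ p ∈ primesIoc z w, ¬ p ∣ n).card : ℕ) : ℝ) ≤
      7 * mertensConst ^ 2 * N * (Real.log z / Real.log w) := by
  set S := (Icc 1 N).filter fun n => ∀ p ∈ primesIoc z w, ¬ p ∣ n with hSdef
  have h1 := card_mul_log_le (N := N) (S := S) (by
    intro n hn
    rw [hSdef, mem_filter, mem_Icc] at hn
    omega) (by
    intro n hn d hd
    rw [hSdef, mem_filter, mem_Icc] at hn ⊢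
    have hd0 := Nat.pos_of_dvd_of_pos hd hn.1.1
    exact ⟨⟨hd0, (Nat.le_of_dvd hn.1.1 hd).trans hn.1.2⟩, fun p hp hpd => hn.2 p hp (hpd.trans hd)⟩)
  have hLN := half_le_log_natCast (hz.trans (hzw.trans hwN))
  have hLw := half_le_log_natCast (hz.trans hzw)
  have hLz := half_le_log_natCast hz
  have h2 : ∑ n ∈ S, 1 / (n : ℝ) ≤
      mertensConst * Real.log N * (mertensConst * (Real.log z / Real.log w)) := by
    have h3 := sum_inv_le_prod_euler (Q := primesIoc 0 N \ primesIoc z w) (S := S)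
      (fun p hp => primesIoc_prime p (mem_sdiff.1 hp).1) (by
        intro n hn
        rw [hSdef, mem_filter, mem_Icc] at hn
        refine ⟨by omega, fun p hp hpn => mem_sdiff.2 ⟨mem_primesIoc.2
          ⟨⟨hp.pos, (Nat.le_of_dvd (by omega) hpn).trans hn.1.2⟩, hp⟩, fun h => hn.2 p h hpn⟩⟩)
    refine h3.trans ?_
    have hsub : primesIoc z w ⊆ primesIoc 0 N := by
      intro p hp
      rw [mem_primesIoc] at hp ⊢
      exact ⟨⟨by omega, by omega⟩, hp.2⟩
    have hpos : 0 < ∏ p ∈ primesIoc z w, (1 - 1 / (p : ℝ)) :=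
      prod_pos fun p hp => one_sub_inv_prime_pos (primesIoc_prime p hp)
    have h4 := prod_sdiff hsub (f := fun p : ℕ => (1 - 1 / (p : ℝ))⁻¹)
    rw [prod_inv_distrib (s := primesIoc z w)] at h4
    have h5 : ∏ p ∈ primesIoc 0 N \ primesIoc z w, (1 - 1 / (p : ℝ))⁻¹ =
        (∏ p ∈ primesIoc 0 N, (1 - 1 / (p : ℝ))⁻¹) * ∏ p ∈ primesIoc z w, (1 - 1 / (p : ℝ)) := by
      rw [← h4]; field_simp
    rw [h5]
    have := mertensConst_pos
    exact mul_le_mul (prod_inv_one_sub_inv_le (hz.trans (hzw.trans hwN)))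
      (prod_one_sub_inv_le hz hzw) hpos.le (by positivity)
  have h6 : (S.card : ℝ) * Real.log N ≤
      (7 * mertensConst ^ 2 * N * (Real.log z / Real.log w)) * Real.log N := by
    refine h1.trans ?_
    calc _ ≤ 7 * N * (mertensConst * Real.log N * (mertensConst * (Real.log z / Real.log w))) := by
          gcongr
      _ = _ := by ring
  exact le_of_mul_le_mul_right h6 (by linarith)

lemma sub_div_mul_sqrt_le {u v : ℝ} (hu : 0 < u) (huv : u ≤ v) (hv : v ≤ 2 * u) :
    (v - u) / (u * √u) ≤ 4 * (1 / √u - 1 / √v) := by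
  have ha : 0 < √u := Real.sqrt_pos.2 hu
  have hb : 0 < √v := Real.sqrt_pos.2 (hu.trans_le huv)
  have hab : √u ≤ √v := Real.sqrt_le_sqrt huv
  have hu2 : √u ^ 2 = u := Real.sq_sqrt hu.le
  have hv2 : √v ^ 2 = v := Real.sq_sqrt (hu.le.trans huv)
  generalize √u = s at *
  generalize √v = t at *
  subst hu2 hv2
  have h1 : t ≤ 3 / 2 * s := by nlinarith
  have h2 : 4 * (1 / s - 1 / t) = 4 * (t - s) / (s * t) := by field_simp
  rw [h2, div_le_div_iff₀ (by positivity) (by positivity)]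
  have h3 : (t + s) * t ≤ 4 * s ^ 2 := by nlinarith
  have h4 : 0 ≤ s * (t - s) := mul_nonneg ha.le (by linarith)
  calc (t ^ 2 - s ^ 2) * (s * t) = s * (t - s) * ((t + s) * t) := by ring
    _ ≤ s * (t - s) * (4 * s ^ 2) := by gcongr
    _ = _ := by ring

lemma sum_inv_mul_sqrt_le {J N : ℕ} (hJ : 1 ≤ J) (hJN : J ≤ N) :
    ∑ j ∈ Ico J N, 1 / ((j : ℝ) * √j) ≤ 4 * (1 / √J - 1 / √N) := by
  induction N, hJN using Nat.le_induction with
  | base => simp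
  | succ n hn ih =>
    rw [sum_Ico_succ_top hn]
    have hn1 : (1 : ℝ) ≤ n := by exact_mod_cast hJ.trans hn
    have := sub_div_mul_sqrt_le (u := n) (v := (n + 1 : ℕ)) (by linarith)
      (by push_cast; linarith) (by push_cast; linarith)
    rw [show (((n + 1 : ℕ) : ℝ) - n) = 1 by push_cast; ring] at this
    linarith

lemma log_natCast_pos {n : ℕ} (hn : 2 ≤ n) : 0 < Real.log n :=
  Real.log_pos (by exact_mod_cast hn)

lemma sum_inv_mul_log_mul_sqrt_log_le {J N : ℕ} (hJ : 2 ≤ J) (hJN : J ≤ N) :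
    ∑ j ∈ Ico J N, 1 / ((j : ℝ) * (Real.log j * √(Real.log j))) ≤
      8 * (1 / √(Real.log J) - 1 / √(Real.log N)) := by
  induction N, hJN using Nat.le_induction with
  | base => simp
  | succ n hn ih =>
    rw [sum_Ico_succ_top hn]
    have hn2 : (2 : ℝ) ≤ n := by exact_mod_cast hJ.trans hn
    have hu : 0 < Real.log n := log_natCast_pos (hJ.trans hn)
    have hle : Real.log n ≤ Real.log (n + 1 : ℕ) :=
      Real.log_le_log (by linarith) (by push_cast; linarith)
    have h2 : Real.log (n + 1 : ℕ) ≤ 2 * Real.log n := by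
      rw [← Nat.cast_two, ← Real.log_pow]
      exact Real.log_le_log (by positivity) (by push_cast; nlinarith)
    have h3 : 1 / (2 * (n : ℝ)) ≤ Real.log (n + 1 : ℕ) - Real.log n := by
      have h4 := Real.one_sub_inv_le_log_of_pos (x := ((n + 1 : ℕ) : ℝ) / n) (by positivity)
      rw [Real.log_div (by positivity) (by positivity), inv_div] at h4
      refine le_trans ?_ h4
      push_cast
      rw [one_sub_div (by positivity), add_sub_cancel_left]
      gcongr
      linarith
    have h5 := sub_div_mul_sqrt_le hu hle h2
    have h6 : 1 / ((n : ℝ) * (Real.log n * √(Real.log n))) ≤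
        2 * ((Real.log (n + 1 : ℕ) - Real.log n) / (Real.log n * √(Real.log n))) := by
      have : 1 / ((n : ℝ) * (Real.log n * √(Real.log n))) =
          2 * ((1 / (2 * (n : ℝ))) / (Real.log n * √(Real.log n))) := by
        field_simp
      rw [this]
      gcongr
    linarith

/-- The primes between consecutive squares `j ^ 2` and `(j + 1) ^ 2`. -/
abbrev primesSq (j : ℕ) : Finset ℕ := primesIoc (j ^ 2) ((j + 1) ^ 2)

lemma theta_natCast (n : ℕ) : Chebyshev.theta n = ∑ p ∈ primesIoc 0 n, Real.log p := by
  rw [Chebyshev.theta, Nat.floor_natCast]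
  rfl

lemma theta_natCast_le (n : ℕ) : Chebyshev.theta n ≤ 2 * n := by
  have h4 : Real.log 4 ≤ 2 := by
    rw [show (4 : ℝ) = 2 ^ 2 by norm_num, Real.log_pow]
    have := Real.log_two_lt_d9
    norm_num at this ⊢
    linarith
  refine (Chebyshev.theta_le_log4_mul_x (Nat.cast_nonneg n)).trans ?_
  gcongr

lemma card_primesSq_mul_log_le {J j : ℕ} (hJ : 1 ≤ J) (hJj : J ≤ j) :
    ((primesSq j).card : ℝ) * (2 * Real.log J) ≤
      Chebyshev.theta ((j + 1) ^ 2 : ℕ) - Chebyshev.theta (j ^ 2 : ℕ) := by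
  rw [theta_natCast, theta_natCast, primesIoc_union (Nat.zero_le (j ^ 2))
    (Nat.pow_le_pow_left (Nat.le_succ j) 2), sum_union (disjoint_primesIoc _ _ _),
    add_sub_cancel_left, ← nsmul_eq_mul]
  refine card_nsmul_le_sum _ _ _ fun p hp => ?_
  rw [← Nat.cast_two, ← Real.log_pow]
  apply Real.log_le_log
  · have : (0 : ℝ) < J := by exact_mod_cast hJ
    positivity
  · have := (mem_primesIoc.1 hp).1.1
    exact_mod_cast (Nat.pow_le_pow_left hJj 2).trans this.le

lemma sum_card_primesSq_le {J N : ℕ} (hJ : 2 ≤ J) (hJN : J ≤ N) :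
    ∑ j ∈ Ico J N, ((primesSq j).card : ℝ) / ((j : ℝ) ^ 2 * √j) ≤ 14 / (√J * Real.log J) := by
  have hJ0 : (0 : ℝ) < J := by exact_mod_cast (by omega : 0 < J)
  have hL := log_natCast_pos hJ
  set f : ℕ → ℝ := fun j => 1 / ((j : ℝ) ^ 2 * √j) with hf
  set T : ℕ → ℝ := fun j => Chebyshev.theta (j ^ 2 : ℕ) with hT
  have hf0 : ∀ j, 0 ≤ f j := fun j => by positivity
  have hT2 : ∀ j, T j ≤ 2 * (j : ℝ) ^ 2 := fun j => by
    have := theta_natCast_le (j ^ 2)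
    simpa [hT] using this
  have hstep : ∀ j, J ≤ j → T (j + 1) * (f j - f (j + 1)) ≤
      2 * (1 / √j - 1 / √(j + 1 : ℕ)) + 6 * (1 / ((j : ℝ) * √j)) := by
    intro j hj
    have hj1 : (1 : ℝ) ≤ j := by exact_mod_cast (by omega : 1 ≤ j)
    have hs : 0 < √(j : ℝ) := by positivity
    have hs' : 0 < √((j + 1 : ℕ) : ℝ) := by positivity
    have hanti : f (j + 1) ≤ f j := by
      simp only [hf]
      gcongr <;> simp
    calc T (j + 1) * (f j - f (j + 1)) ≤ 2 * ((j + 1 : ℕ) : ℝ) ^ 2 * (f j - f (j + 1)) := by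
          have := hT2 (j + 1)
          have h0 : 0 ≤ f j - f (j + 1) := by linarith
          gcongr
      _ = 2 * ((((j : ℝ) + 1) / j) ^ 2 * (1 / √j) - 1 / √(j + 1 : ℕ)) := by
          simp only [hf]
          have : ((j + 1 : ℕ) : ℝ) ≠ 0 := by positivity
          have h2 : ((j : ℝ) + 1) = ((j + 1 : ℕ) : ℝ) := by push_cast; rfl
          rw [h2]
          generalize √((j + 1 : ℕ) : ℝ) = t at *
          generalize √(j : ℝ) = s at *
          field_simp
      _ ≤ 2 * ((1 + 3 / j) * (1 / √j) - 1 / √(j + 1 : ℕ)) := by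
          gcongr
          rw [div_pow, div_le_iff₀ (by positivity),
            show (1 + 3 / (j : ℝ)) * (j : ℝ) ^ 2 = (j : ℝ) ^ 2 + 3 * j by field_simp]
          nlinarith
      _ = _ := by
          generalize √((j + 1 : ℕ) : ℝ) = t at *
          generalize √(j : ℝ) = s at *
          field_simp
          ring
  have key : ∀ n, J ≤ n → ∑ j ∈ Ico J n, (T (j + 1) - T j) * f j ≤
      T n * f n + 2 * (1 / √J - 1 / √n) + 6 * ∑ j ∈ Ico J n, 1 / ((j : ℝ) * √j) := by
    intro n hn
    induction n, hn using Nat.le_induction with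
    | base =>
      have : 0 ≤ T J * f J := mul_nonneg (Chebyshev.theta_nonneg _) (hf0 J)
      simpa using this
    | succ n hn ih =>
      rw [sum_Ico_succ_top hn, sum_Ico_succ_top hn]
      have := hstep n hn
      linarith
  have h1 := key N hJN
  have h2 := sum_inv_mul_sqrt_le (by omega : 1 ≤ J) hJN
  have hN0 : (0 : ℝ) < N := hJ0.trans_le (by exact_mod_cast hJN)
  have h3 : T N * f N ≤ 2 * (1 / √N) := by
    calc T N * f N ≤ 2 * (N : ℝ) ^ 2 * f N := by exact mul_le_mul_of_nonneg_right (hT2 N) (hf0 N)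
      _ = _ := by simp only [hf]; field_simp
  have h5 : 0 ≤ 1 / √(N : ℝ) := by positivity
  have h4 : (∑ j ∈ Ico J N, ((primesSq j).card : ℝ) / ((j : ℝ) ^ 2 * √j)) * (2 * Real.log J) ≤
      28 * (1 / √J) := by
    rw [sum_mul]
    calc _ ≤ ∑ j ∈ Ico J N, (T (j + 1) - T j) * f j := by
          refine sum_le_sum fun j hj => ?_
          have := card_primesSq_mul_log_le (by omega : 1 ≤ J) (mem_Ico.1 hj).1
          calc _ = ((primesSq j).card : ℝ) * (2 * Real.log J) * f j := by simp only [hf]; ring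
            _ ≤ _ := mul_le_mul_of_nonneg_right this (hf0 j)
      _ ≤ _ := by
        have h6 : 1 / √(N : ℝ) ≤ 1 / √J := by gcongr
        linarith
  rw [← le_div_iff₀ (by positivity)] at h4
  refine h4.trans (le_of_eq ?_)
  field_simp
  norm_num

lemma sum_sqrt_card_primesSq_le {J N : ℕ} (hJ : 2 ≤ J) (hJN : J ≤ N) :
    ∑ j ∈ Ico J N, √((primesSq j).card : ℝ) / (j : ℝ) ^ 2 ≤ 8 * (1 / √(J * Real.log J)) := by
  have hJ0 : (0 : ℝ) < J := by exact_mod_cast (by omega : 0 < J)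
  have hL := log_natCast_pos hJ
  have h1 : ∑ j ∈ Ico J N, 1 / ((j : ℝ) * √j) ≤ 4 / √J := by
    have := sum_inv_mul_sqrt_le (by omega : 1 ≤ J) hJN
    have h5 : 0 ≤ 1 / √(N : ℝ) := by positivity
    rw [← mul_one_div]
    linarith
  have h2 := sum_card_primesSq_le hJ hJN
  calc _ = ∑ j ∈ Ico J N, √(1 / ((j : ℝ) * √j)) *
        √(((primesSq j).card : ℝ) / ((j : ℝ) ^ 2 * √j)) := by
        refine sum_congr rfl fun j hj => ?_
        have hj : (0 : ℝ) < j := by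
          have := (mem_Ico.1 hj).1
          exact_mod_cast (by omega : 0 < j)
        rw [← Real.sqrt_mul (by positivity), div_mul_div_comm,
          show (j : ℝ) * √j * ((j : ℝ) ^ 2 * √j) = ((j : ℝ) ^ 2) ^ 2 by
            have := Real.mul_self_sqrt hj.le
            linear_combination (j : ℝ) ^ 3 * this, one_mul, Real.sqrt_div (by positivity),
          Real.sqrt_sq (by positivity)]
    _ ≤ √(∑ j ∈ Ico J N, 1 / ((j : ℝ) * √j)) *
        √(∑ j ∈ Ico J N, ((primesSq j).card : ℝ) / ((j : ℝ) ^ 2 * √j)) :=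
        Real.sum_sqrt_mul_sqrt_le _ (fun _ => by positivity) (fun _ => by positivity)
    _ ≤ √(4 / √J) * √(14 / (√J * Real.log J)) := by gcongr
    _ = √(56 / (J * Real.log J)) := by
        rw [← Real.sqrt_mul (by positivity), div_mul_div_comm, ← mul_assoc,
          Real.mul_self_sqrt hJ0.le]
        norm_num
    _ ≤ √(8 ^ 2 / (J * Real.log J)) := by gcongr; norm_num
    _ = _ := by
        rw [Real.sqrt_div (by positivity), Real.sqrt_sq (by norm_num), mul_one_div]

lemma card_primesSq_le {j : ℕ} (hj : 1 ≤ j) : (primesSq j).card ≤ 3 * j := by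
  refine (card_filter_le _ _).trans ?_
  rw [Nat.card_Ioc]
  have : (j + 1) ^ 2 = j ^ 2 + 2 * j + 1 := by ring
  omega

lemma sum_card_primesSq_sq_le {J N : ℕ} (hJ : 2 ≤ J) (hJN : J ≤ N) :
    ∑ j ∈ Ico J N, ((primesSq j).card : ℝ) ^ 2 / (j : ℝ) ^ 4 ≤ 42 / (J * Real.log J) := by
  have hJ0 : (0 : ℝ) < J := by exact_mod_cast (by omega : 0 < J)
  have hL := log_natCast_pos hJ
  calc _ ≤ ∑ j ∈ Ico J N, 3 / √J * (((primesSq j).card : ℝ) / ((j : ℝ) ^ 2 * √j)) := by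
        refine sum_le_sum fun j hj => ?_
        have hJj := (mem_Ico.1 hj).1
        have hj0 : (0 : ℝ) < j := by exact_mod_cast (by omega : 0 < j)
        have hc : ((primesSq j).card : ℝ) ≤ 3 * j := by
          exact_mod_cast card_primesSq_le (by omega : 1 ≤ j)
        have hs : √(J : ℝ) ≤ √j := Real.sqrt_le_sqrt (by exact_mod_cast hJj)
        have hs0 : 0 < √(J : ℝ) := by positivity
        calc ((primesSq j).card : ℝ) ^ 2 / (j : ℝ) ^ 4
            ≤ (3 * j * (primesSq j).card) / (j : ℝ) ^ 4 := by
              rw [pow_two]; gcongr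
          _ = 3 / √j * (((primesSq j).card : ℝ) / ((j : ℝ) ^ 2 * √j)) := by
              have := Real.sq_sqrt hj0.le
              have hs1 : 0 < √(j : ℝ) := by positivity
              generalize √(j : ℝ) = s at *
              rw [← this]
              field_simp
          _ ≤ _ := by gcongr
    _ = 3 / √J * ∑ j ∈ Ico J N, ((primesSq j).card : ℝ) / ((j : ℝ) ^ 2 * √j) := by rw [mul_sum]
    _ ≤ 3 / √J * (14 / (√J * Real.log J)) := by
        gcongr; exact sum_card_primesSq_le hJ hJN
    _ = _ := by
        rw [div_mul_div_comm, ← mul_assoc, Real.mul_self_sqrt hJ0.le]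
        norm_num

/-- The integers `1 ≤ n ≤ N` without prime factors in `(z, w]`. -/
def sifted (z w N : ℕ) : Finset ℕ :=
  (Icc 1 N).filter fun n => ∀ p ∈ primesIoc z w, ¬ p ∣ n

lemma mem_sifted {z w N n : ℕ} :
    n ∈ sifted z w N ↔ (1 ≤ n ∧ n ≤ N) ∧ ∀ p ∈ primesIoc z w, ¬ p ∣ n := by
  simp [sifted]

/-- The integers up to `N` divisible by a product of two primes from the same block. -/
def doubled (J₀ J₁ N : ℕ) : Finset ℕ :=
  (Icc 1 N).filter fun n => ∃ j ∈ Ico J₀ J₁, ∃ p ∈ primesSq j, ∃ q ∈ primesSq j, p * q ∣ n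

/-- The integers up to `N` whose first block of prime factors is the `j`-th one, with exactly one
prime factor in it. -/
def single (J₀ N j : ℕ) : Finset ℕ :=
  (sifted (J₀ ^ 2) (j ^ 2) N).filter fun n => (∃ p ∈ primesSq j, p ∣ n) ∧
    ∀ p ∈ primesSq j, ∀ q ∈ primesSq j, ¬ p * q ∣ n

lemma mem_single {J₀ N j n : ℕ} : n ∈ single J₀ N j ↔ n ∈ sifted (J₀ ^ 2) (j ^ 2) N ∧
    (∃ p ∈ primesSq j, p ∣ n) ∧ ∀ p ∈ primesSq j, ∀ q ∈ primesSq j, ¬ p * q ∣ n := by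
  simp [single]

lemma primesSq_subset {J₀ J₁ j : ℕ} (h0 : J₀ ≤ j) (h1 : j < J₁) :
    primesSq j ⊆ primesIoc (J₀ ^ 2) (J₁ ^ 2) := by
  intro p hp
  rw [mem_primesIoc] at hp ⊢
  have h2 := Nat.pow_le_pow_left h0 2
  have h3 := Nat.pow_le_pow_left (show j + 1 ≤ J₁ from h1) 2
  exact ⟨⟨by omega, by omega⟩, hp.2⟩

lemma exists_mem_primesSq {J₀ J₁ p : ℕ} (hp : p ∈ primesIoc (J₀ ^ 2) (J₁ ^ 2)) :
    ∃ j ∈ Ico J₀ J₁, p ∈ primesSq j := by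
  rw [mem_primesIoc] at hp
  refine ⟨Nat.sqrt (p - 1), ?_, ?_⟩
  · rw [mem_Ico, Nat.le_sqrt', Nat.sqrt_lt']
    omega
  · rw [mem_primesIoc]
    have h1 := Nat.sqrt_le' (p - 1)
    have h2 := Nat.lt_succ_sqrt' (p - 1)
    rw [Nat.succ_eq_add_one] at h2
    exact ⟨by omega, hp.2⟩

lemma mem_cover {J₀ J₁ N n : ℕ} (hn : n ∈ Icc 1 N) (hF : n ∉ sifted (J₀ ^ 2) (J₁ ^ 2) N)
    (hB : n ∉ doubled J₀ J₁ N) : ∃ j ∈ Ico J₀ J₁, n ∈ single J₀ N j := by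
  classical
  rw [mem_Icc] at hn
  have hex : ∃ j, j ∈ Ico J₀ J₁ ∧ ∃ p ∈ primesSq j, p ∣ n := by
    by_contra! hcon
    refine hF (mem_sifted.2 ⟨hn, fun p hp hpn => ?_⟩)
    obtain ⟨j, hj, hpj⟩ := exists_mem_primesSq hp
    exact hcon j hj p hpj hpn
  obtain ⟨hj, hp⟩ := Nat.find_spec hex
  have hmin := fun i => Nat.find_min hex (m := i)
  set j := Nat.find hex
  refine ⟨j, hj, mem_single.2 ⟨mem_sifted.2 ⟨hn, fun p hp' hpn => ?_⟩, hp, fun p hp q hq hpq => ?_⟩⟩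
  · obtain ⟨i, hi, hpi⟩ := exists_mem_primesSq hp'
    rw [mem_Ico] at hi hj
    exact hmin i hi.2 ⟨mem_Ico.2 ⟨hi.1, hi.2.trans hj.2⟩, p, hpi, hpn⟩
  · exact hB (mem_filter.2 ⟨mem_Icc.2 hn, j, hj, p, hp, q, hq, hpq⟩)

lemma norm_sum_le_of_decomposition (G : ℕ → ℂ) (J₀ J₁ N : ℕ) :
    ‖∑ n ∈ Icc 1 N, G n‖ ≤ ∑ n ∈ sifted (J₀ ^ 2) (J₁ ^ 2) N, ‖G n‖ +
      ∑ n ∈ doubled J₀ J₁ N, ‖G n‖ + ∑ j ∈ Ico J₀ J₁, ‖∑ n ∈ single J₀ N j, G n‖ := by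
  classical
  set U := (Ico J₀ J₁).biUnion (single J₀ N) with hU
  have hUsub : U ⊆ Icc 1 N := by
    intro n hn
    obtain ⟨j, -, hn⟩ := mem_biUnion.1 hn
    exact mem_Icc.2 (mem_sifted.1 (mem_single.1 hn).1).1
  have hdisj : (↑(Ico J₀ J₁) : Set ℕ).PairwiseDisjoint (single J₀ N) := by
    have key : ∀ i j n, J₀ ≤ i → i < j → n ∈ single J₀ N i → n ∉ single J₀ N j := by
      intro i j n hi hij hni hnj
      obtain ⟨p, hp, hpn⟩ := (mem_single.1 hni).2.1
      exact (mem_sifted.1 (mem_single.1 hnj).1).2 p (primesSq_subset hi hij hp) hpn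
    intro i hi j hj hij
    rw [mem_coe, mem_Ico] at hi hj
    rw [Function.onFun, disjoint_left]
    intro n hni hnj
    rcases lt_or_gt_of_ne hij with h | h
    · exact key i j n hi.1 h hni hnj
    · exact key j i n hj.1 h hnj hni
  rw [← sum_sdiff hUsub]
  refine (norm_add_le _ _).trans (add_le_add ?_ ?_)
  · have hsub : Icc 1 N \ U ⊆ sifted (J₀ ^ 2) (J₁ ^ 2) N ∪ doubled J₀ J₁ N := by
      intro n hn
      rw [mem_sdiff] at hn
      by_contra hcon
      rw [mem_union, not_or] at hcon
      obtain ⟨j, hj, hnj⟩ := mem_cover hn.1 hcon.1 hcon.2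
      exact hn.2 (mem_biUnion.2 ⟨j, hj, hnj⟩)
    calc _ ≤ ∑ n ∈ Icc 1 N \ U, ‖G n‖ := norm_sum_le _ _
      _ ≤ ∑ n ∈ sifted (J₀ ^ 2) (J₁ ^ 2) N ∪ doubled J₀ J₁ N, ‖G n‖ :=
        sum_le_sum_of_subset_of_nonneg hsub fun _ _ _ => norm_nonneg _
      _ ≤ _ := by
        rw [← sum_union_inter]
        exact le_add_of_nonneg_right (sum_nonneg fun _ _ => norm_nonneg _)
  · rw [hU, sum_biUnion hdisj]
    exact norm_sum_le _ _

lemma sum_single_eq (G : ℕ → ℂ) {J₀ N j : ℕ} (hj : J₀ ≤ j) :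
    ∑ n ∈ single J₀ N j, G n =
      ∑ p ∈ primesSq j, ∑ m ∈ sifted (J₀ ^ 2) ((j + 1) ^ 2) (N / p), G (p * m) := by
  have hsplit : ∀ p, p ∈ primesIoc (J₀ ^ 2) ((j + 1) ^ 2) ↔
      p ∈ primesIoc (J₀ ^ 2) (j ^ 2) ∨ p ∈ primesSq j := by
    intro p
    rw [primesIoc_union (Nat.pow_le_pow_left hj 2) (Nat.pow_le_pow_left (Nat.le_succ j) 2),
      mem_union]
  have hndvd : ∀ p m, p ∈ primesSq j → m ∈ sifted (J₀ ^ 2) ((j + 1) ^ 2) (N / p) →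
      ∀ q ∈ primesSq j, ¬ q ∣ m :=
    fun p m _ hm q hq => (mem_sifted.1 hm).2 q ((hsplit q).2 (Or.inr hq))
  rw [sum_sigma']
  symm
  refine sum_nbij (fun t => t.1 * t.2) ?_ ?_ ?_ (fun _ _ => rfl)
  · rintro ⟨p, m⟩ hpm
    rw [mem_sigma] at hpm
    obtain ⟨hp, hm⟩ := hpm
    dsimp only at hp hm ⊢
    have hpp := primesIoc_prime p hp
    have hm' := mem_sifted.1 hm
    rw [mem_single, mem_sifted]
    refine ⟨⟨⟨Nat.mul_pos hpp.pos hm'.1.1, ?_⟩, fun q hq hqn => ?_⟩,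
      ⟨p, hp, dvd_mul_right p m⟩, fun q hq r hr hqr => ?_⟩
    · rw [mul_comm]
      exact (Nat.le_div_iff_mul_le hpp.pos).1 hm'.1.2
    · rcases (primesIoc_prime q hq).dvd_mul.1 hqn with h | h
      · rw [Nat.prime_dvd_prime_iff_eq (primesIoc_prime q hq) hpp] at h
        subst h
        have h1 := (mem_primesIoc.1 hq).1.2
        have h2 := (mem_primesIoc.1 hp).1.1
        omega
      · exact hm'.2 q ((hsplit q).2 (Or.inl hq)) h
    · have hqp : q ∣ p := by
        rcases (primesIoc_prime q hq).dvd_mul.1 ((dvd_mul_right q r).trans hqr) with h | h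
        · exact h
        · exact absurd h (hndvd p m hp hm q hq)
      rw [Nat.prime_dvd_prime_iff_eq (primesIoc_prime q hq) hpp] at hqp
      subst hqp
      exact hndvd q m hp hm r hr (Nat.dvd_of_mul_dvd_mul_left hpp.pos hqr)
  · rintro ⟨p, m⟩ hpm ⟨q, l⟩ hql h
    rw [mem_coe, mem_sigma] at hpm hql
    dsimp only at hpm hql h
    have hpp := primesIoc_prime p hpm.1
    have hpq : p = q := by
      have h1 : p ∣ q * l := h ▸ dvd_mul_right p m
      rcases hpp.dvd_mul.1 h1 with h2 | h2
      · exact (Nat.prime_dvd_prime_iff_eq hpp (primesIoc_prime q hql.1)).1 h2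
      · exact absurd h2 (hndvd q l hql.1 hql.2 p hpm.1)
    subst hpq
    rw [Nat.eq_of_mul_eq_mul_left hpp.pos h]
  · intro n hn
    rw [mem_coe, mem_single, mem_sifted] at hn
    obtain ⟨⟨hn1, hn2⟩, ⟨p, hp, m, rfl⟩, hn3⟩ := hn
    have hpp := primesIoc_prime p hp
    refine ⟨⟨p, m⟩, ?_, rfl⟩
    rw [mem_coe, mem_sigma]
    refine ⟨hp, mem_sifted.2 ⟨⟨Nat.pos_of_mul_pos_left hn1.1, ?_⟩, fun q hq hqm => ?_⟩⟩
    · rw [Nat.le_div_iff_mul_le hpp.pos, mul_comm]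
      exact hn1.2
    · rcases (hsplit q).1 hq with h | h
      · exact hn2 q h (hqm.mul_left p)
      · exact hn3 p hp q h (mul_dvd_mul_left p hqm)

lemma card_doubled_le (J₀ J₁ N : ℕ) (hJ₀ : 1 ≤ J₀) :
    ((doubled J₀ J₁ N).card : ℝ) ≤
      N * ∑ j ∈ Ico J₀ J₁, ((primesSq j).card : ℝ) ^ 2 / (j : ℝ) ^ 4 := by
  classical
  have hsub : doubled J₀ J₁ N ⊆ (Ico J₀ J₁).biUnion fun j => (primesSq j).biUnion fun p =>
      (primesSq j).biUnion fun q => (Ioc 0 N).filter (p * q ∣ ·) := by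
    intro n hn
    rw [doubled, mem_filter, mem_Icc] at hn
    obtain ⟨hn1, j, hj, p, hp, q, hq, h⟩ := hn
    simp only [mem_biUnion, mem_filter, mem_Ioc]
    exact ⟨j, hj, p, hp, q, hq, ⟨hn1.1, hn1.2⟩, h⟩
  have h1 : (doubled J₀ J₁ N).card ≤ ∑ j ∈ Ico J₀ J₁, ∑ p ∈ primesSq j, ∑ q ∈ primesSq j,
      N / (p * q) := by
    refine (card_le_card hsub).trans (card_biUnion_le.trans (sum_le_sum fun j _ => ?_))
    refine card_biUnion_le.trans (sum_le_sum fun p _ => ?_)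
    refine card_biUnion_le.trans (sum_le_sum fun q _ => ?_)
    rw [Nat.Ioc_filter_dvd_card_eq_div]
  have h2 : ((doubled J₀ J₁ N).card : ℝ) ≤ ∑ j ∈ Ico J₀ J₁, ∑ p ∈ primesSq j, ∑ q ∈ primesSq j,
      ((N / (p * q) : ℕ) : ℝ) := by exact_mod_cast h1
  refine h2.trans ?_
  rw [mul_sum]
  refine sum_le_sum fun j hj => ?_
  have hj0 : (0 : ℝ) < j := by
    have := (mem_Ico.1 hj).1
    exact_mod_cast (by omega : 0 < j)
  calc _ ≤ ∑ p ∈ primesSq j, ∑ q ∈ primesSq j, (N : ℝ) / (j : ℝ) ^ 4 := by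
        refine sum_le_sum fun p hp => sum_le_sum fun q hq => ?_
        have hp1 : (j : ℝ) ^ 2 ≤ p := by exact_mod_cast (mem_primesIoc.1 hp).1.1.le
        have hq1 : (j : ℝ) ^ 2 ≤ q := by exact_mod_cast (mem_primesIoc.1 hq).1.1.le
        refine Nat.cast_div_le.trans ?_
        push_cast
        have : (j : ℝ) ^ 4 ≤ p * q := by
          calc (j : ℝ) ^ 4 = (j : ℝ) ^ 2 * (j : ℝ) ^ 2 := by ring
            _ ≤ _ := by gcongr
        gcongr
    _ = _ := by
        simp only [sum_const, nsmul_eq_mul]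
        ring

lemma sum_norm_le_sqrt_card (a : ℕ → ℂ) (S : Finset ℕ) :
    ∑ n ∈ S, ‖a n‖ ≤ √(S.card : ℝ) * √(∑ n ∈ S, ‖a n‖ ^ 2) := by
  have := Real.sum_mul_le_sqrt_mul_sqrt S (fun _ => 1) (fun n => ‖a n‖)
  simpa using this

lemma sum_norm_sq_bilinear_le {A : ℝ} (hA : 0 ≤ A) {b φ : ℕ → ℂ} {P : Finset ℕ} (Y : ℕ)
    (hb : ∀ p ∈ P, ‖b p‖ ≤ A) (hφ : ∀ n, ‖φ n‖ ≤ 1) :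
    ∑ m ∈ Icc 1 Y, ‖∑ p ∈ P, b p * φ (p * m)‖ ^ 2 ≤
      A ^ 2 * (P.card * Y + ∑ p ∈ P, ∑ q ∈ P.erase p,
        ‖∑ m ∈ Icc 1 Y, φ (p * m) * starRingEnd ℂ (φ (q * m))‖) := by
  have h1 : ((∑ m ∈ Icc 1 Y, ‖∑ p ∈ P, b p * φ (p * m)‖ ^ 2 : ℝ) : ℂ) =
      ∑ p ∈ P, ∑ q ∈ P, b p * starRingEnd ℂ (b q) *
        ∑ m ∈ Icc 1 Y, φ (p * m) * starRingEnd ℂ (φ (q * m)) := by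
    push_cast
    simp_rw [← Complex.mul_conj', map_sum, sum_mul_sum, mul_sum]
    rw [sum_comm]
    refine sum_congr rfl fun p _ => ?_
    rw [sum_comm]
    refine sum_congr rfl fun q _ => sum_congr rfl fun m _ => ?_
    rw [map_mul]
    ring
  have h2 : ∑ m ∈ Icc 1 Y, ‖∑ p ∈ P, b p * φ (p * m)‖ ^ 2 =
      ‖((∑ m ∈ Icc 1 Y, ‖∑ p ∈ P, b p * φ (p * m)‖ ^ 2 : ℝ) : ℂ)‖ := by
    rw [Complex.norm_real, Real.norm_of_nonneg (sum_nonneg fun _ _ => by positivity)]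
  have hterm : ∀ p ∈ P, ∀ q ∈ P, ‖b p * starRingEnd ℂ (b q) *
      ∑ m ∈ Icc 1 Y, φ (p * m) * starRingEnd ℂ (φ (q * m))‖ ≤
      A ^ 2 * ‖∑ m ∈ Icc 1 Y, φ (p * m) * starRingEnd ℂ (φ (q * m))‖ := by
    intro p hp q hq
    rw [norm_mul, norm_mul, RCLike.norm_conj, pow_two]
    have := hb p hp
    have := hb q hq
    gcongr
  have hdiag : ∀ p ∈ P, ‖∑ m ∈ Icc 1 Y, φ (p * m) * starRingEnd ℂ (φ (p * m))‖ ≤ Y := by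
    intro p _
    calc _ ≤ ∑ m ∈ Icc 1 Y, ‖φ (p * m) * starRingEnd ℂ (φ (p * m))‖ := norm_sum_le _ _
      _ ≤ ∑ m ∈ Icc 1 Y, (1 : ℝ) := by
          refine sum_le_sum fun m _ => ?_
          rw [norm_mul, RCLike.norm_conj]
          exact mul_le_one₀ (hφ _) (norm_nonneg _) (hφ _)
      _ = _ := by simp
  rw [h2, h1]
  calc _ ≤ ∑ p ∈ P, ∑ q ∈ P, A ^ 2 *
        ‖∑ m ∈ Icc 1 Y, φ (p * m) * starRingEnd ℂ (φ (q * m))‖ :=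
        (norm_sum_le _ _).trans (sum_le_sum fun p hp =>
          (norm_sum_le _ _).trans (sum_le_sum fun q hq => hterm p hp q hq))
    _ = A ^ 2 * ∑ p ∈ P, (‖∑ m ∈ Icc 1 Y, φ (p * m) * starRingEnd ℂ (φ (p * m))‖ +
        ∑ q ∈ P.erase p, ‖∑ m ∈ Icc 1 Y, φ (p * m) * starRingEnd ℂ (φ (q * m))‖) := by
        simp_rw [← mul_sum]
        congr 1
        refine sum_congr rfl fun p hp => ?_
        rw [add_sum_erase P (fun q => ‖∑ m ∈ Icc 1 Y, φ (p * m) * starRingEnd ℂ (φ (q * m))‖) hp]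
    _ ≤ _ := by
        rw [sum_add_distrib]
        gcongr
        rw [← nsmul_eq_mul]
        exact sum_le_card_nsmul _ _ _ hdiag

/-- Splitting of the sum over a block of primes into a bilinear sum over a rectangle and a
remainder. -/
lemma norm_sum_single_le {A : ℝ} (hA : 0 ≤ A) {a φ : ℕ → ℂ}
    (hmul : ∀ m n : ℕ, Nat.Coprime m n → a (m * n) = a m * a n)
    (ha : ∀ p : ℕ, p.Prime → ‖a p‖ ≤ A) (hφ : ∀ n, ‖φ n‖ ≤ 1)
    {J₀ N j Y Z : ℕ} (hj : J₀ ≤ j) (hY : Y * (j + 1) ^ 2 ≤ N) (hZ : N / j ^ 2 ≤ Z)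
    (hj1 : 1 ≤ j) :
    ‖∑ n ∈ single J₀ N j, a n * φ n‖ ≤
      √(∑ m ∈ sifted (J₀ ^ 2) ((j + 1) ^ 2) Y, ‖a m‖ ^ 2) *
        √(A ^ 2 * ((primesSq j).card * Y + ∑ p ∈ primesSq j, ∑ q ∈ (primesSq j).erase p,
          ‖∑ m ∈ Icc 1 Y, φ (p * m) * starRingEnd ℂ (φ (q * m))‖)) +
      (primesSq j).card * (A * ∑ m ∈ Ioc Y Z, ‖a m‖) := by
  classical
  rw [sum_single_eq _ hj]
  set W := (j + 1) ^ 2 with hW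
  have hsub : ∀ p ∈ primesSq j, sifted (J₀ ^ 2) W Y ⊆ sifted (J₀ ^ 2) W (N / p) := by
    intro p hp m hm
    rw [mem_sifted] at hm ⊢
    have hp' := mem_primesIoc.1 hp
    refine ⟨⟨hm.1.1, hm.1.2.trans ?_⟩, hm.2⟩
    rw [Nat.le_div_iff_mul_le hp'.2.pos]
    exact (Nat.mul_le_mul_left Y hp'.1.2).trans hY
  have hfac : ∀ p ∈ primesSq j, ∀ m ∈ sifted (J₀ ^ 2) W (N / p), a (p * m) = a p * a m := by
    intro p hp m hm
    refine hmul p m (((primesIoc_prime p hp).coprime_iff_not_dvd).2 ?_)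
    exact (mem_sifted.1 hm).2 p (primesSq_subset hj (Nat.lt_succ_self j) hp)
  have hsplit : ∑ p ∈ primesSq j, ∑ m ∈ sifted (J₀ ^ 2) W (N / p), a (p * m) * φ (p * m) =
      ∑ m ∈ sifted (J₀ ^ 2) W Y, a m * ∑ p ∈ primesSq j, a p * φ (p * m) +
      ∑ p ∈ primesSq j, ∑ m ∈ sifted (J₀ ^ 2) W (N / p) \ sifted (J₀ ^ 2) W Y,
        a p * (a m * φ (p * m)) := by
    simp_rw [mul_sum]
    rw [sum_comm (s := sifted (J₀ ^ 2) W Y), ← sum_add_distrib]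
    refine sum_congr rfl fun p hp => ?_
    rw [add_comm, ← sum_sdiff (hsub p hp)]
    congr 1
    · exact sum_congr rfl fun m hm => by rw [hfac p hp m (mem_sdiff.1 hm).1]; ring
    · exact sum_congr rfl fun m hm => by rw [hfac p hp m (hsub p hp hm)]; ring
  rw [hsplit]
  refine (norm_add_le _ _).trans (add_le_add ?_ ?_)
  · calc _ ≤ ∑ m ∈ sifted (J₀ ^ 2) W Y, ‖a m‖ * ‖∑ p ∈ primesSq j, a p * φ (p * m)‖ :=
          (norm_sum_le _ _).trans (sum_le_sum fun m _ => (norm_mul _ _).le)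
      _ ≤ √(∑ m ∈ sifted (J₀ ^ 2) W Y, ‖a m‖ ^ 2) *
          √(∑ m ∈ sifted (J₀ ^ 2) W Y, ‖∑ p ∈ primesSq j, a p * φ (p * m)‖ ^ 2) :=
          Real.sum_mul_le_sqrt_mul_sqrt _ _ _
      _ ≤ _ := by
          gcongr
          refine le_trans (sum_le_sum_of_subset_of_nonneg (filter_subset _ _)
            fun _ _ _ => by positivity) (sum_norm_sq_bilinear_le hA Y
              (fun p hp => ha p (primesIoc_prime p hp)) hφ)
  · rw [← nsmul_eq_mul]
    refine (norm_sum_le _ _).trans (sum_le_card_nsmul _ _ _ fun p hp => ?_)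
    have hsub2 : sifted (J₀ ^ 2) W (N / p) \ sifted (J₀ ^ 2) W Y ⊆ Ioc Y Z := by
      intro m hm
      rw [mem_sdiff, mem_sifted, mem_sifted] at hm
      obtain ⟨⟨⟨h1, h2⟩, h3⟩, h4⟩ := hm
      rw [mem_Ioc]
      constructor
      · by_contra hcon
        exact h4 ⟨⟨h1, by omega⟩, h3⟩
      · refine (h2.trans ?_).trans hZ
        exact Nat.div_le_div_left (mem_primesIoc.1 hp).1.1.le (by positivity)
    calc _ ≤ ∑ m ∈ sifted (J₀ ^ 2) W (N / p) \ sifted (J₀ ^ 2) W Y, A * ‖a m‖ := by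
          refine (norm_sum_le _ _).trans (sum_le_sum fun m _ => ?_)
          rw [norm_mul, norm_mul]
          have h1 := ha p (primesIoc_prime p hp)
          calc ‖a p‖ * (‖a m‖ * ‖φ (p * m)‖) ≤ A * (‖a m‖ * 1) := by
                gcongr
                exact hφ _
            _ = _ := by ring
      _ ≤ ∑ m ∈ Ioc Y Z, A * ‖a m‖ :=
          sum_le_sum_of_subset_of_nonneg hsub2 fun _ _ _ => by positivity
      _ = _ := by rw [mul_sum]

lemma sqrt_add_le {u v : ℝ} (hu : 0 ≤ u) (hv : 0 ≤ v) : √(u + v) ≤ √u + √v := by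
  rw [Real.sqrt_le_left (by positivity)]
  nlinarith [Real.sq_sqrt hu, Real.sq_sqrt hv, mul_nonneg (Real.sqrt_nonneg u) (Real.sqrt_nonneg v)]

lemma floor_div_sub_floor_div_le {x : ℝ} {j : ℕ} (hj : 1 ≤ j) (hx : (j : ℝ) ^ 3 ≤ x) :
    ((Ioc ⌊x / ((j : ℝ) + 1) ^ 2⌋₊ ⌊x / (j : ℝ) ^ 2⌋₊).card : ℝ) ≤ 4 * x / (j : ℝ) ^ 3 := by
  have hj1 : (1 : ℝ) ≤ j := by exact_mod_cast hj
  have hx0 : 0 < x := lt_of_lt_of_le (by positivity) hx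
  have hle : ⌊x / ((j : ℝ) + 1) ^ 2⌋₊ ≤ ⌊x / (j : ℝ) ^ 2⌋₊ := by
    apply Nat.floor_le_floor
    gcongr
    linarith
  rw [Nat.card_Ioc, Nat.cast_sub hle]
  have h1 := Nat.floor_le (show 0 ≤ x / (j : ℝ) ^ 2 by positivity)
  have h2 := Nat.lt_floor_add_one (x / ((j : ℝ) + 1) ^ 2)
  have h3 : x / (j : ℝ) ^ 2 - x / ((j : ℝ) + 1) ^ 2 ≤ 3 * x / (j : ℝ) ^ 3 := by
    rw [div_sub_div _ _ (by positivity) (by positivity), div_le_div_iff₀ (by positivity)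
      (by positivity)]
    have h4 : ((j : ℝ) + 1) ^ 2 - (j : ℝ) ^ 2 ≤ 3 * j := by nlinarith
    have h5 : (j : ℝ) ^ 2 ≤ ((j : ℝ) + 1) ^ 2 := by nlinarith
    calc _ = x * (j : ℝ) ^ 3 * (((j : ℝ) + 1) ^ 2 - (j : ℝ) ^ 2) := by ring
      _ ≤ x * (j : ℝ) ^ 3 * (3 * j) := by gcongr
      _ = 3 * x * ((j : ℝ) ^ 2 * (j : ℝ) ^ 2) := by ring
      _ ≤ 3 * x * ((j : ℝ) ^ 2 * ((j : ℝ) + 1) ^ 2) := by gcongr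
  have h6 : 1 ≤ x / (j : ℝ) ^ 3 := (one_le_div (by positivity)).2 hx
  have h7 : 4 * x / (j : ℝ) ^ 3 = 3 * x / (j : ℝ) ^ 3 + x / (j : ℝ) ^ 3 := by ring
  linarith

lemma sqrt_mul_sqrt_block_le {A C D τ L P y Y Q V : ℝ} {j : ℕ} (hA : 0 ≤ A) (hC : 0 ≤ C)
    (hD : 0 ≤ D) (hτ : 0 ≤ τ) (hL : 0 ≤ L) (hP : 0 ≤ P) (hy : 0 ≤ y) (hYy : Y ≤ y) (hj : 2 ≤ j)
    (hV1 : V ≤ 1) (hVL : V ≤ L / Real.log j)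
    (hQ : Q ≤ C * τ * (j : ℝ) ^ 2 * y / Real.log ((j : ℝ) ^ 2) ^ 2) :
    √(D * y * V) * √(A ^ 2 * (P * Y + Q)) ≤
      A * √D * y * (√P + √C * √τ * √L * (j / (Real.log j * √(Real.log j)))) := by
  have hlog : 0 < Real.log j := log_natCast_pos hj
  have hj0 : (0 : ℝ) < j := by exact_mod_cast (by omega : 0 < j)
  have h1 : √(A ^ 2 * (P * Y + Q)) ≤ A * √y * (√P + √C * √τ * (j / Real.log j)) := by
    have h2 : A ^ 2 * (P * Y + Q) ≤ A ^ 2 * (y * (P + (C * τ * (j / Real.log j) ^ 2))) := by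
      gcongr
      have h3 : C * τ * (j : ℝ) ^ 2 * y / Real.log ((j : ℝ) ^ 2) ^ 2 ≤
          y * (C * τ * (j / Real.log j) ^ 2) := by
        rw [Real.log_pow, Nat.cast_two, mul_pow, div_pow]
        have : C * τ * (j : ℝ) ^ 2 * y / (2 ^ 2 * Real.log j ^ 2) =
          (y * (C * τ * ((j : ℝ) ^ 2 / Real.log j ^ 2))) / 4 := by field_simp; norm_num
        rw [this]
        have : 0 ≤ y * (C * τ * ((j : ℝ) ^ 2 / Real.log j ^ 2)) := by positivity
        linarith
      have := mul_le_mul_of_nonneg_left hYy hP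
      linarith
    calc _ ≤ √(A ^ 2 * (y * (P + (C * τ * (j / Real.log j) ^ 2)))) := Real.sqrt_le_sqrt h2
      _ = A * √y * √(P + (C * τ * (j / Real.log j) ^ 2)) := by
          rw [Real.sqrt_mul (by positivity), Real.sqrt_sq hA, Real.sqrt_mul hy]
          ring
      _ ≤ A * √y * (√P + √(C * τ * (j / Real.log j) ^ 2)) := by
          gcongr
          exact sqrt_add_le hP (by positivity)
      _ = _ := by
          rw [Real.sqrt_mul (by positivity), Real.sqrt_sq (by positivity), Real.sqrt_mul hC]
  have hVs1 : √V ≤ 1 := Real.sqrt_le_one.2 hV1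
  have hVs2 : √V ≤ √L / √(Real.log j) := by
    rw [← Real.sqrt_div hL]
    exact Real.sqrt_le_sqrt hVL
  calc _ ≤ √D * √y * √V * (A * √y * (√P + √C * √τ * (j / Real.log j))) := by
        rw [Real.sqrt_mul (by positivity), Real.sqrt_mul hD]
        gcongr
    _ = A * √D * (√y * √y) * (√V * √P + √V * (√C * √τ * (j / Real.log j))) := by ring
    _ ≤ A * √D * y * (1 * √P + √L / √(Real.log j) * (√C * √τ * (j / Real.log j))) := by
        rw [Real.mul_self_sqrt hy]
        gcongr
    _ = _ := by
        field_simp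

lemma norm_sum_single_le_of_meanSquare {A C D τ L V x : ℝ} {a φ : ℕ → ℂ} {J₀ j : ℕ}
    (hA : 0 ≤ A) (hC : 0 ≤ C) (hD : 0 ≤ D) (hτ : 0 ≤ τ) (hL : 0 ≤ L)
    (hmul : ∀ m n : ℕ, Nat.Coprime m n → a (m * n) = a m * a n)
    (ha : ∀ p : ℕ, p.Prime → ‖a p‖ ≤ A) (hφ : ∀ n, ‖φ n‖ ≤ 1)
    (hJj : J₀ ≤ j) (hj : 2 ≤ j) (hx : (j : ℝ) ^ 3 ≤ x)
    (hV1 : V ≤ 1) (hVL : V ≤ L / Real.log j)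
    (hfull : ∑ m ∈ Icc 1 ⌊x / (j : ℝ) ^ 2⌋₊, ‖a m‖ ^ 2 ≤ D * (x / (j : ℝ) ^ 2))
    (hsift : ∑ m ∈ sifted (J₀ ^ 2) ((j + 1) ^ 2) ⌊x / ((j : ℝ) + 1) ^ 2⌋₊, ‖a m‖ ^ 2 ≤
      D * (x / ((j : ℝ) + 1) ^ 2) * V)
    (hcor : ∑ p ∈ primesSq j, ∑ q ∈ (primesSq j).erase p,
      ‖∑ m ∈ Icc 1 ⌊x / ((j : ℝ) + 1) ^ 2⌋₊, φ (p * m) * starRingEnd ℂ (φ (q * m))‖ ≤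
      C * τ * (j : ℝ) ^ 2 * (x / ((j : ℝ) + 1) ^ 2) / Real.log ((j : ℝ) ^ 2) ^ 2) :
    ‖∑ n ∈ single J₀ ⌊x⌋₊ j, a n * φ n‖ ≤
      A * √D * x * (√((primesSq j).card : ℝ) / (j : ℝ) ^ 2 +
        √C * √τ * √L * (1 / ((j : ℝ) * (Real.log j * √(Real.log j)))) +
        2 * (((primesSq j).card : ℝ) / ((j : ℝ) ^ 2 * √j))) := by
  have hj0 : (0 : ℝ) < j := by exact_mod_cast (by omega : 0 < j)
  have hx0 : 0 < x := lt_of_lt_of_le (by positivity) hx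
  have hlog : 0 < Real.log j := log_natCast_pos hj
  have hfl := Nat.floor_le (show 0 ≤ x / ((j : ℝ) + 1) ^ 2 by positivity)
  have hY : ⌊x / ((j : ℝ) + 1) ^ 2⌋₊ * (j + 1) ^ 2 ≤ ⌊x⌋₊ := by
    apply Nat.le_floor
    push_cast
    rwa [← le_div_iff₀ (by positivity)]
  have hZ : ⌊x⌋₊ / j ^ 2 ≤ ⌊x / (j : ℝ) ^ 2⌋₊ := by
    rw [← Nat.floor_div_natCast]
    simp
  refine (norm_sum_single_le hA hmul ha hφ hJj hY hZ (by omega)).trans ?_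
  set y := x / ((j : ℝ) + 1) ^ 2 with hydef
  have hy0 : 0 ≤ y := by positivity
  have hyx : y ≤ x / (j : ℝ) ^ 2 := by
    rw [hydef]
    gcongr
    linarith
  set P : ℝ := ((primesSq j).card : ℝ) with hP
  have hP0 : 0 ≤ P := by positivity
  have hmain := sqrt_mul_sqrt_block_le hA hC hD hτ hL hP0 hy0 hfl hj hV1 hVL hcor
  have h1 : √(∑ m ∈ sifted (J₀ ^ 2) ((j + 1) ^ 2) ⌊y⌋₊, ‖a m‖ ^ 2) ≤ √(D * y * V) :=
    Real.sqrt_le_sqrt hsift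
  have hrem : ∑ m ∈ Ioc ⌊y⌋₊ ⌊x / (j : ℝ) ^ 2⌋₊, ‖a m‖ ≤
      √D * (2 * (x / ((j : ℝ) ^ 2 * √j))) := by
    calc _ ≤ √((Ioc ⌊y⌋₊ ⌊x / (j : ℝ) ^ 2⌋₊).card : ℝ) *
          √(∑ m ∈ Ioc ⌊y⌋₊ ⌊x / (j : ℝ) ^ 2⌋₊, ‖a m‖ ^ 2) := sum_norm_le_sqrt_card a _
      _ ≤ √(4 * x / (j : ℝ) ^ 3) * √(D * (x / (j : ℝ) ^ 2)) := by
          gcongr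
          · exact floor_div_sub_floor_div_le (by omega) hx
          · refine le_trans (sum_le_sum_of_subset_of_nonneg ?_ fun _ _ _ => by positivity) hfull
            intro m hm
            rw [mem_Ioc] at hm
            exact mem_Icc.2 ⟨by omega, hm.2⟩
      _ = √(D * (2 * (x / ((j : ℝ) ^ 2 * √j))) ^ 2) := by
          rw [← Real.sqrt_mul (by positivity)]
          congr 1
          have := Real.sq_sqrt hj0.le
          have hs : 0 < √(j : ℝ) := by positivity
          generalize √(j : ℝ) = s at *
          rw [← this]
          field_simp
          ring
      _ = _ := by rw [Real.sqrt_mul hD, Real.sqrt_sq (by positivity)]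
  have hS : 0 ≤ √P + √C * √τ * √L * (j / (Real.log j * √(Real.log j))) := by positivity
  calc _ ≤ A * √D * y * (√P + √C * √τ * √L * (j / (Real.log j * √(Real.log j)))) +
        P * (A * (√D * (2 * (x / ((j : ℝ) ^ 2 * √j))))) := by
        refine add_le_add (le_trans ?_ hmain) (by gcongr)
        gcongr
    _ ≤ A * √D * (x / (j : ℝ) ^ 2) * (√P + √C * √τ * √L * (j / (Real.log j * √(Real.log j)))) +
        P * (A * (√D * (2 * (x / ((j : ℝ) ^ 2 * √j))))) := by gcongr
    _ = _ := by
        have : 0 < √(Real.log j) := by positivity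
        have hs : 0 < √(j : ℝ) := by positivity
        field_simp

lemma primeFactors_prod_primesIoc (z w : ℕ) :
    (∏ p ∈ primesIoc z w, p).primeFactors = primesIoc z w :=
  Nat.primeFactors_prod primesIoc_prime

lemma filter_coprime_prod_eq_sifted (z w N : ℕ) :
    (Icc 1 N).filter (fun n => Nat.Coprime n (∏ p ∈ primesIoc z w, p)) = sifted z w N := by
  ext n
  rw [mem_filter, mem_sifted, mem_Icc, Nat.coprime_prod_right_iff]
  refine and_congr_right fun _ => forall₂_congr fun p hp => ?_
  rw [Nat.coprime_comm, (primesIoc_prime p hp).coprime_iff_not_dvd]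

/-- The mean square bound for `a` over integers coprime to the primes of an interval. -/
def MeanSquareBound (C c x H K : ℝ) (a : ℕ → ℂ) : Prop :=
  ∀ z w : ℝ, H ^ 2 / 2 ≤ z → z < w → w ≤ 2 * K ^ 2 →
    ∀ Pbar : ℕ, (Pbar = 1 ∨ Pbar = ∏ p ∈ primesIn z w, p) →
    ∀ y : ℝ, c * x / w ≤ y →
      ∑ n ∈ (Icc 1 ⌊y⌋₊).filter (fun n => Nat.Coprime n Pbar), ‖a n‖ ^ 2 ≤
        C * y * ∏ p ∈ Pbar.primeFactors, (1 - 1 / (p : ℝ))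

/-- The bound for the correlations of `φ` along pairs of distinct primes of a short interval. -/
def CorrelationBound (C τ x H K : ℝ) (φ : ℕ → ℂ) : Prop :=
  ∀ z w y : ℝ, H ^ 2 / 2 ≤ z → z < w → w ≤ 2 * K ^ 2 →
    2 * √z ≤ w - z → w - z ≤ 3 * √z → x / (2 * z) ≤ y → y ≤ x / z →
      ∑ p ∈ primesIn z w, ∑ q ∈ (primesIn z w).erase p,
          ‖∑ m ∈ Icc 1 ⌊y⌋₊, φ (p * m) * starRingEnd ℂ (φ (q * m))‖ ≤
        C * τ * z * y / Real.log z ^ 2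

lemma MeanSquareBound.sum_sifted_le {C c x H K : ℝ} {a : ℕ → ℂ} (h : MeanSquareBound C c x H K a)
    {z w : ℕ} (hz : H ^ 2 / 2 ≤ (z : ℝ)) (hzw : z < w) (hw : (w : ℝ) ≤ 2 * K ^ 2)
    {y : ℝ} (hy : c * x / w ≤ y) :
    ∑ n ∈ sifted z w ⌊y⌋₊, ‖a n‖ ^ 2 ≤ C * y * ∏ p ∈ primesIoc z w, (1 - 1 / (p : ℝ)) := by
  have := h z w hz (by exact_mod_cast hzw) hw _ (Or.inr rfl) y hy
  rwa [primesIn_natCast, filter_coprime_prod_eq_sifted, primeFactors_prod_primesIoc] at this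

lemma MeanSquareBound.sum_le {C c x H K : ℝ} {a : ℕ → ℂ} (h : MeanSquareBound C c x H K a)
    (hH : 0 ≤ H) (hHK : H < K) {y : ℝ} (hy : c * x / (2 * K ^ 2) ≤ y) :
    ∑ n ∈ Icc 1 ⌊y⌋₊, ‖a n‖ ^ 2 ≤ C * y := by
  have := h (H ^ 2 / 2) (2 * K ^ 2) le_rfl (by nlinarith) le_rfl 1 (Or.inl rfl) y hy
  simpa using this

lemma prod_one_sub_inv_le_one (z w : ℕ) : ∏ p ∈ primesIoc z w, (1 - 1 / (p : ℝ)) ≤ 1 := by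
  refine prod_le_one (fun p hp => (one_sub_inv_prime_pos (primesIoc_prime p hp)).le) fun p _ => ?_
  have : 0 ≤ 1 / (p : ℝ) := by positivity
  linarith

/-- Summation of the block bounds. -/
lemma sum_block_bounds_le {B M C τ x : ℝ} {J N : ℕ} {T : ℕ → ℝ} (hB : 0 ≤ B) (hx : 0 ≤ x)
    (hM : 0 ≤ M) (hJ : 3 ≤ J) (hJN : J ≤ N)
    (hT : ∀ j ∈ Ico J N, T j ≤ B * x * (√((primesSq j).card : ℝ) / (j : ℝ) ^ 2 +
        √C * √τ * √(M * Real.log J) * (1 / ((j : ℝ) * (Real.log j * √(Real.log j)))) +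
        2 * (((primesSq j).card : ℝ) / ((j : ℝ) ^ 2 * √j)))) :
    ∑ j ∈ Ico J N, T j ≤
      B * x * (36 * (1 / √(J * Real.log J)) + 8 * √C * √M * √τ) := by
  have hJ3 : (3 : ℝ) ≤ J := by exact_mod_cast hJ
  have hlog : 1 ≤ Real.log J := by
    rw [Real.le_log_iff_exp_le (by linarith)]
    have := Real.exp_one_lt_d9
    linarith
  have hlogN : 0 ≤ 1 / √(Real.log N) := by positivity
  have h1 := sum_sqrt_card_primesSq_le (by omega : 2 ≤ J) hJN
  have h2 := sum_inv_mul_log_mul_sqrt_log_le (by omega : 2 ≤ J) hJN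
  have h3 := sum_card_primesSq_le (by omega : 2 ≤ J) hJN
  have h4 : 14 / (√J * Real.log J) ≤ 14 * (1 / √(J * Real.log J)) := by
    rw [Real.sqrt_mul (by positivity), mul_one_div]
    have : √(Real.log J) ≤ Real.log J := Real.sqrt_le_self_iff.2 (Or.inr hlog)
    gcongr
  have h5 : √C * √τ * √(M * Real.log J) * ∑ j ∈ Ico J N,
      1 / ((j : ℝ) * (Real.log j * √(Real.log j))) ≤ 8 * √C * √M * √τ := by
    calc _ ≤ √C * √τ * √(M * Real.log J) * (8 * (1 / √(Real.log J))) := by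
          gcongr
          linarith
      _ = _ := by
          rw [Real.sqrt_mul hM]
          field_simp
  refine (sum_le_sum hT).trans ?_
  rw [← mul_sum, sum_add_distrib, sum_add_distrib, ← mul_sum, ← mul_sum]
  refine mul_le_mul_of_nonneg_left ?_ (by positivity)
  linarith

lemma norm_sum_single_le_of_bounds {A C c τ x H K : ℝ} {a φ : ℕ → ℂ} {J₀ j : ℕ}
    (hA : 0 ≤ A) (hC : 0 ≤ C) (hτ : 0 ≤ τ)
    (hmul : ∀ m n : ℕ, Nat.Coprime m n → a (m * n) = a m * a n)
    (ha : ∀ p : ℕ, p.Prime → ‖a p‖ ≤ A) (hφ : ∀ n, ‖φ n‖ ≤ 1)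
    (hms : MeanSquareBound C c x H K a) (hcor : CorrelationBound C τ x H K φ)
    (hH : 0 ≤ H) (hHJ : H ≤ J₀) (hJ : 3 ≤ J₀) (hJj : J₀ ≤ j) (hjK : (j : ℝ) + 1 ≤ K)
    (hKx : K ^ 3 ≤ x) :
    ‖∑ n ∈ single J₀ ⌊x⌋₊ j, a n * φ n‖ ≤
      A * √(C * max 1 c) * x * (√((primesSq j).card : ℝ) / (j : ℝ) ^ 2 +
        √C * √τ * √(mertensConst * Real.log J₀) * (1 / ((j : ℝ) * (Real.log j * √(Real.log j)))) +
        2 * (((primesSq j).card : ℝ) / ((j : ℝ) ^ 2 * √j))) := by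
  have hj3 : (3 : ℝ) ≤ j := by exact_mod_cast hJ.trans hJj
  have hj0 : (0 : ℝ) < j := by linarith
  have hHj : H ≤ j := hHJ.trans (by exact_mod_cast hJj)
  have hlogJ : 0 < Real.log J₀ := log_natCast_pos (by omega)
  have hlogj : 0 < Real.log j := log_natCast_pos (by omega)
  have hjx : (j : ℝ) ^ 3 ≤ x := le_trans (by gcongr; linarith) hKx
  have hx0 : 0 < x := lt_of_lt_of_le (by positivity) hjx
  have hc1 : 1 ≤ max 1 c := le_max_left _ _
  have hc2 : c ≤ max 1 c := le_max_right _ _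
  have hjK2 : ((j : ℝ) + 1) ^ 2 ≤ 2 * K ^ 2 := by nlinarith
  have hM := mertensConst_pos
  have hmono : ∀ {u : ℝ}, 0 ≤ u → ⌊u⌋₊ ≤ ⌊max 1 c * u⌋₊ := fun hu =>
    Nat.floor_le_floor (le_mul_of_one_le_left hu hc1)
  refine norm_sum_single_le_of_meanSquare (V := ∏ p ∈ primesIoc (J₀ ^ 2) ((j + 1) ^ 2),
    (1 - 1 / (p : ℝ))) hA hC (by positivity) hτ (by positivity) hmul ha hφ hJj (by omega) hjx
    (prod_one_sub_inv_le_one _ _) ?_ ?_ ?_ ?_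
  · refine (prod_one_sub_inv_le (by nlinarith) (Nat.pow_le_pow_left (by omega) 2)).trans ?_
    push_cast
    rw [Real.log_pow, Real.log_pow, Nat.cast_two, mul_div_mul_left _ _ (by norm_num : (2 : ℝ) ≠ 0),
      mul_div_assoc]
    gcongr
    linarith
  · have h := hms.sum_le hH (by linarith : H < K) (y := max 1 c * (x / (j : ℝ) ^ 2)) (by
      rw [← mul_div_assoc]
      gcongr
      nlinarith)
    refine le_trans (sum_le_sum_of_subset_of_nonneg ?_ fun _ _ _ => by positivity)
      (h.trans_eq (by ring))
    exact Icc_subset_Icc_right (hmono (by positivity))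
  · have h := hms.sum_sifted_le (z := J₀ ^ 2) (w := (j + 1) ^ 2)
      (y := max 1 c * (x / ((j : ℝ) + 1) ^ 2)) (by push_cast; nlinarith)
      (Nat.pow_lt_pow_left (by omega) (by norm_num)) (by push_cast; exact hjK2) (by
        push_cast
        rw [← mul_div_assoc]
        gcongr)
    refine le_trans (sum_le_sum_of_subset_of_nonneg ?_ fun _ _ _ => by positivity)
      (h.trans_eq (by ring))
    exact filter_subset_filter _ (Icc_subset_Icc_right (hmono (by positivity)))
  · have hsqrt : √((j : ℝ) ^ 2) = j := Real.sqrt_sq hj0.le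
    have h := hcor ((j : ℝ) ^ 2) (((j : ℝ) + 1) ^ 2) (x / ((j : ℝ) + 1) ^ 2) (by nlinarith)
      (by nlinarith) hjK2 (by rw [hsqrt]; nlinarith) (by rw [hsqrt]; nlinarith)
      (by gcongr; nlinarith) (by gcongr; linarith)
    have hprimes : primesIn ((j : ℝ) ^ 2) (((j : ℝ) + 1) ^ 2) = primesSq j := by
      have := primesIn_natCast (j ^ 2) ((j + 1) ^ 2)
      push_cast at this
      exact this
    rwa [hprimes] at h

lemma sum_norm_sifted_le {C c x H K : ℝ} {a : ℕ → ℂ} {z w : ℕ} (hC : 0 ≤ C) (hx : 0 ≤ x)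
    (hms : MeanSquareBound C c x H K a) (hz2 : 2 ≤ z) (hz : H ^ 2 / 2 ≤ (z : ℝ)) (hzw : z < w)
    (hw : (w : ℝ) ≤ 2 * K ^ 2) (hwx : (w : ℝ) ≤ x) (hcw : c ≤ w) :
    ∑ n ∈ sifted z w ⌊x⌋₊, ‖a n‖ ≤
      √(7 * mertensConst ^ 3 * C) * x * (Real.log z / Real.log w) := by
  have hM := mertensConst_pos
  have hlogz : 0 < Real.log z := log_natCast_pos hz2
  have hlogw : 0 < Real.log w := log_natCast_pos (by omega)
  have hw0 : (0 : ℝ) < w := by exact_mod_cast (by omega : 0 < w)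
  have h1 := card_sifted_le hz2 hzw.le (Nat.le_floor hwx)
  have h2 := hms.sum_sifted_le hz hzw hw (y := x) (by
    rw [div_le_iff₀ hw0, mul_comm]
    gcongr)
  have h3 := prod_one_sub_inv_le hz2 hzw.le
  have hfl := Nat.floor_le hx
  set ρ := Real.log z / Real.log w
  have hρ : 0 < ρ := by positivity
  calc _ ≤ √((sifted z w ⌊x⌋₊).card : ℝ) * √(∑ n ∈ sifted z w ⌊x⌋₊, ‖a n‖ ^ 2) :=
        sum_norm_le_sqrt_card a _
    _ ≤ √(7 * mertensConst ^ 2 * x * ρ) * √(C * x * (mertensConst * ρ)) := by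
        gcongr
        · exact h1.trans (by gcongr)
        · exact h2.trans (by gcongr)
    _ = √(7 * mertensConst ^ 3 * C * (x * ρ) ^ 2) := by
        rw [← Real.sqrt_mul (by positivity)]
        congr 1
        ring
    _ = _ := by
        rw [Real.sqrt_mul (by positivity), Real.sqrt_sq (by positivity)]
        ring

lemma sum_norm_doubled_le {C x : ℝ} {a : ℕ → ℂ} {J₀ J₁ : ℕ} (hC : 0 ≤ C) (hx : 0 ≤ x)
    (hJ₀ : 2 ≤ J₀) (hJ : J₀ ≤ J₁) (hfull : ∑ n ∈ Icc 1 ⌊x⌋₊, ‖a n‖ ^ 2 ≤ C * x) :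
    ∑ n ∈ doubled J₀ J₁ ⌊x⌋₊, ‖a n‖ ≤ √(42 * C) * x * (1 / √(J₀ * Real.log J₀)) := by
  have hlog : 0 < Real.log J₀ := log_natCast_pos hJ₀
  have hfl := Nat.floor_le hx
  have h1 := card_doubled_le J₀ J₁ ⌊x⌋₊ (by omega)
  have h2 := sum_card_primesSq_sq_le hJ₀ hJ
  calc _ ≤ √((doubled J₀ J₁ ⌊x⌋₊).card : ℝ) * √(∑ n ∈ doubled J₀ J₁ ⌊x⌋₊, ‖a n‖ ^ 2) :=
        sum_norm_le_sqrt_card a _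
    _ ≤ √(x * (42 / (J₀ * Real.log J₀))) * √(C * x) := by
        gcongr
        · exact h1.trans (by gcongr)
        · exact (sum_le_sum_of_subset_of_nonneg (filter_subset _ _)
            fun _ _ _ => by positivity).trans hfull
    _ = √(42 * C * x ^ 2 / (J₀ * Real.log J₀)) := by
        rw [← Real.sqrt_mul (by positivity)]
        congr 1
        ring
    _ = _ := by
        rw [Real.sqrt_div (by positivity), Real.sqrt_mul (by positivity), Real.sqrt_sq hx]
        ring

lemma sum_norm_le_of_meanSquare {C x : ℝ} {a : ℕ → ℂ} (hx : 0 ≤ x)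
    (hfull : ∑ n ∈ Icc 1 ⌊x⌋₊, ‖a n‖ ^ 2 ≤ C * x) :
    ∑ n ∈ Icc 1 ⌊x⌋₊, ‖a n‖ ≤ √C * x := by
  have hfl := Nat.floor_le hx
  calc _ ≤ √((Icc 1 ⌊x⌋₊).card : ℝ) * √(∑ n ∈ Icc 1 ⌊x⌋₊, ‖a n‖ ^ 2) :=
        sum_norm_le_sqrt_card a _
    _ ≤ √x * √(C * x) := by
        gcongr
        simpa using hfl
    _ = √C * x := by
        rw [Real.sqrt_mul' _ hx]
        rw [mul_left_comm, Real.mul_self_sqrt hx]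

lemma log_ceil_div_log_floor_le {H K : ℝ} (hH : 4 ≤ H) (hK : 4 ≤ K) :
    Real.log (⌈H⌉₊ : ℝ) / Real.log (⌊K⌋₊ : ℝ) ≤ 4 * (Real.log H / Real.log K) := by
  have h1 : Real.log (⌈H⌉₊ : ℝ) ≤ 2 * Real.log H := by
    have := Nat.ceil_lt_add_one (show 0 ≤ H by linarith)
    rw [← Nat.cast_two (R := ℝ), ← Real.log_pow]
    exact Real.log_le_log (by positivity) (by nlinarith)
  have h2 : Real.log K ≤ 2 * Real.log (⌊K⌋₊ : ℝ) := by
    have := Nat.lt_floor_add_one K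
    rw [← Nat.cast_two (R := ℝ), ← Real.log_pow]
    exact Real.log_le_log (by positivity) (by nlinarith)
  have h3 : 0 < Real.log K := Real.log_pos (by linarith)
  have h4 : 0 < Real.log H := Real.log_pos (by linarith)
  rw [← mul_div_assoc, div_le_div_iff₀ (by linarith) h3]
  nlinarith

lemma one_le_two_mul_log_div_log {H K : ℝ} (hH : 4 ≤ H) (hHK : H < K) (h : ⌊K⌋₊ ≤ ⌈H⌉₊) :
    1 ≤ 2 * (Real.log H / Real.log K) := by
  have h1 := Nat.ceil_lt_add_one (show 0 ≤ H by linarith)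
  have h2 := Nat.lt_floor_add_one K
  have h3 : (⌊K⌋₊ : ℝ) ≤ ⌈H⌉₊ := by exact_mod_cast h
  rw [← mul_div_assoc, one_le_div (Real.log_pos (by linarith)), ← Nat.cast_two (R := ℝ),
    ← Real.log_pow]
  exact Real.log_le_log (by linarith) (by nlinarith)

lemma lt_of_exp_rpow_le {H₀ δ x H : ℝ} (hH₀ : 0 ≤ H₀) (hδ : 0 < δ)
    (hx : Real.exp (H₀ ^ (1 / δ)) ≤ x) (hH : Real.log x ^ δ < H) : H₀ < H := by
  refine lt_of_le_of_lt ?_ hH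
  have h1 : H₀ ^ (1 / δ) ≤ Real.log x :=
    (Real.le_log_iff_exp_le ((Real.exp_pos _).trans_le hx)).2 hx
  calc H₀ = (H₀ ^ (1 / δ)) ^ δ := by
        rw [← Real.rpow_mul hH₀, one_div_mul_cancel hδ.ne', Real.rpow_one]
    _ ≤ _ := by gcongr

lemma cube_le_of_lt_rpow {δ x K : ℝ} (hδ : δ ≤ 1 / 10) (hx : 1 ≤ x) (hK : 1 ≤ K)
    (h : K < x ^ δ) : K ^ 3 ≤ x := by
  calc K ^ 3 ≤ K ^ 10 := pow_le_pow_right₀ hK (by norm_num)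
    _ ≤ (x ^ δ) ^ 10 := by gcongr
    _ = x ^ (δ * (10 : ℕ)) := by rw [Real.rpow_mul_natCast (by linarith)]
    _ ≤ x ^ (1 : ℝ) := Real.rpow_le_rpow_of_exponent_le hx (by push_cast; linarith)
    _ = x := Real.rpow_one x

/-- The criterion with explicit constants. -/
lemma norm_sum_le_of_bounds {A C c τ x H K : ℝ} {a φ : ℕ → ℂ}
    (hA : 0 ≤ A) (hC : 0 ≤ C) (hτ : 0 ≤ τ) (hH : 4 ≤ H) (hcH : c ≤ H) (hHK : H < K)
    (hKx : K ^ 3 ≤ x)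
    (hmul : ∀ m n : ℕ, Nat.Coprime m n → a (m * n) = a m * a n)
    (ha : ∀ p : ℕ, p.Prime → ‖a p‖ ≤ A) (hφ : ∀ n, ‖φ n‖ ≤ 1)
    (hms : MeanSquareBound C c x H K a) (hcor : CorrelationBound C τ x H K φ) :
    ‖∑ n ∈ Icc 1 ⌊x⌋₊, a n * φ n‖ ≤
      x * ((36 * (A * √(C * max 1 c)) + √(42 * C)) * (1 / √(H * Real.log H)) +
        8 * (A * √(C * max 1 c)) * √C * √mertensConst * √τ +
        (4 * √(7 * mertensConst ^ 3 * C) + 2 * √C) * (Real.log H / Real.log K)) := by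
  have hK0 : 0 < K := by linarith
  have hx0 : 0 < x := lt_of_lt_of_le (by positivity) hKx
  have hK2 : K ^ 2 ≤ x := le_trans (by nlinarith [sq_nonneg K]) hKx
  have hlogH : 0 < Real.log H := Real.log_pos (by linarith)
  have hlogK : 0 < Real.log K := Real.log_pos (by linarith)
  have hG : ∀ n, ‖a n * φ n‖ ≤ ‖a n‖ := fun n => by
    rw [norm_mul]
    exact mul_le_of_le_one_right (norm_nonneg _) (hφ n)
  have hfull : ∑ n ∈ Icc 1 ⌊x⌋₊, ‖a n‖ ^ 2 ≤ C * x := hms.sum_le (by linarith) hHK (by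
    rw [div_le_iff₀ (by nlinarith), mul_comm]
    gcongr
    nlinarith)
  rcases le_or_gt ⌊K⌋₊ ⌈H⌉₊ with hle | hlt
  · have h1 := one_le_two_mul_log_div_log hH hHK hle
    calc _ ≤ ∑ n ∈ Icc 1 ⌊x⌋₊, ‖a n‖ := norm_sum_le_of_le _ fun n _ => hG n
      _ ≤ √C * x * 1 := by rw [mul_one]; exact sum_norm_le_of_meanSquare hx0.le hfull
      _ ≤ √C * x * (2 * (Real.log H / Real.log K)) := by gcongr
      _ = x * (0 + 0 + (0 + 2 * √C) * (Real.log H / Real.log K)) := by ring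
      _ ≤ _ := by gcongr <;> positivity
  set J₀ := ⌈H⌉₊ with hJ₀
  set J₁ := ⌊K⌋₊ with hJ₁
  have hHJ : H ≤ J₀ := Nat.le_ceil H
  have hJ4 : 4 ≤ J₀ := by exact_mod_cast hH.trans hHJ
  have hJK : (J₁ : ℝ) ≤ K := Nat.floor_le (by linarith)
  have hJ₁4 : (4 : ℝ) ≤ J₁ := by exact_mod_cast hJ4.trans hlt.le
  have hHJ₁ : H ≤ J₁ := hHJ.trans (by exact_mod_cast hlt.le)
  have hF : ∑ n ∈ sifted (J₀ ^ 2) (J₁ ^ 2) ⌊x⌋₊, ‖a n‖ ≤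
      √(7 * mertensConst ^ 3 * C) * x * (4 * (Real.log H / Real.log K)) := by
    refine (sum_norm_sifted_le hC hx0.le hms (by nlinarith) (by push_cast; nlinarith)
      (Nat.pow_lt_pow_left hlt (by norm_num)) (by push_cast; nlinarith) (by push_cast; nlinarith)
      (by push_cast; nlinarith)).trans ?_
    push_cast
    rw [Real.log_pow, Real.log_pow, Nat.cast_two, mul_div_mul_left _ _ (by norm_num : (2 : ℝ) ≠ 0)]
    gcongr
    exact log_ceil_div_log_floor_le hH (by linarith)
  have hR : 1 / √(J₀ * Real.log J₀) ≤ 1 / √(H * Real.log H) := by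
    have := Real.log_le_log (by linarith) hHJ
    gcongr
  have hB : ∑ n ∈ doubled J₀ J₁ ⌊x⌋₊, ‖a n‖ ≤ √(42 * C) * x * (1 / √(H * Real.log H)) :=
    (sum_norm_doubled_le hC hx0.le (by omega) hlt.le hfull).trans (by gcongr)
  have hT := sum_block_bounds_le (B := A * √(C * max 1 c)) (J := J₀) (N := J₁) (C := C) (τ := τ)
    (by positivity) hx0.le mertensConst_pos.le (by omega) hlt.le
    (T := fun j => ‖∑ n ∈ single J₀ ⌊x⌋₊ j, a n * φ n‖) fun j hj => by
      rw [mem_Ico] at hj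
      have : (j : ℝ) + 1 ≤ J₁ := by exact_mod_cast hj.2
      exact norm_sum_single_le_of_bounds hA hC hτ hmul ha hφ hms hcor (by linarith) hHJ (by omega)
        hj.1 (by linarith) hKx
  have hT' : A * √(C * max 1 c) * x * (36 * (1 / √(J₀ * Real.log J₀)) +
      8 * √C * √mertensConst * √τ) ≤ A * √(C * max 1 c) * x * (36 * (1 / √(H * Real.log H)) +
      8 * √C * √mertensConst * √τ) := by gcongr
  have h0 : 0 ≤ x * (2 * √C * (Real.log H / Real.log K)) := by positivity
  calc _ ≤ _ := norm_sum_le_of_decomposition _ J₀ J₁ _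
    _ ≤ √(7 * mertensConst ^ 3 * C) * x * (4 * (Real.log H / Real.log K)) +
        √(42 * C) * x * (1 / √(H * Real.log H)) + A * √(C * max 1 c) * x *
        (36 * (1 / √(H * Real.log H)) + 8 * √C * √mertensConst * √τ) :=
        add_le_add (add_le_add ((sum_le_sum fun n _ => hG n).trans hF)
          ((sum_le_sum fun n _ => hG n).trans hB)) (hT.trans hT')
    _ ≤ _ := by linarith

/-- Extended Bourgain–Sarnak–Ziegler theorem (Theorem 1, qualitative core).
Let `log^δ x < H < K < x^δ` with `0 < δ ≤ 1/10`, `a` multiplicative with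
`|a(p)| ≤ A`, `|φ| ≤ 1`. Assume (a): for every prime interval
`𝒫 = {z < p ≤ w}` with `H²/2 ≤ z < w ≤ 2K²`, every `P̄ ∈ {1, ∏_{p∈𝒫} p}` and
every `y ≥ c·x/w`, `∑_{n≤y,(n,P̄)=1} |a(n)|² ≤ C y ∏_{p|P̄}(1-1/p)`; and
(b): whenever moreover `w - z ≍ √z` and `y ≍ x/z`,
`∑_{p≠q∈𝒫} |∑_{m≤y} φ(pm) conj(φ(qm))| ≤ C τ z y / log² z`. Then
`∑_{n ≤ x} a(n)φ(n) ≪ x (1/√(H log H) + √τ + log H / log K)`. -/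
theorem stmt19 (A C c δ : ℝ) (hA : 0 < A) (hC : 0 < C) (hc : 0 < c)
    (hδ : 0 < δ) (hδ' : δ ≤ 1 / 10) :
    ∃ K₀ x₀ : ℝ, 0 < K₀ ∧
      ∀ (x H K : ℝ) (a φ : ℕ → ℂ) (τ : ℝ),
        x₀ ≤ x →
        Real.log x ^ δ < H → H < K → K < x ^ δ →
        (∀ m n : ℕ, Nat.Coprime m n → a (m * n) = a m * a n) →
        (∀ p : ℕ, p.Prime → ‖a p‖ ≤ A) →
        (∀ n : ℕ, ‖φ n‖ ≤ 1) →
        0 ≤ τ → τ ≤ 1 →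
        (∀ z w : ℝ, H ^ 2 / 2 ≤ z → z < w → w ≤ 2 * K ^ 2 →
          ∀ Pbar : ℕ, (Pbar = 1 ∨ Pbar = ∏ p ∈ primesIn z w, p) →
          ∀ y : ℝ, c * x / w ≤ y →
            ∑ n ∈ (Finset.Icc 1 ⌊y⌋₊).filter (fun n => Nat.Coprime n Pbar),
                ‖a n‖ ^ 2 ≤
              C * y * ∏ p ∈ Pbar.primeFactors, (1 - 1 / (p : ℝ))) →
        (∀ z w y : ℝ, H ^ 2 / 2 ≤ z → z < w → w ≤ 2 * K ^ 2 →
          2 * Real.sqrt z ≤ w - z → w - z ≤ 3 * Real.sqrt z →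
          x / (2 * z) ≤ y → y ≤ x / z →
            ∑ p ∈ primesIn z w, ∑ q ∈ (primesIn z w).erase p,
                ‖∑ m ∈ Finset.Icc 1 ⌊y⌋₊, φ (p * m) * starRingEnd ℂ (φ (q * m))‖ ≤
              C * τ * z * y / Real.log z ^ 2) →
        ‖∑ n ∈ Finset.Icc 1 ⌊x⌋₊, a n * φ n‖ ≤
          K₀ * x * (1 / Real.sqrt (H * Real.log H) + Real.sqrt τ +
            Real.log H / Real.log K) := by
  set k₁ := 36 * (A * √(C * max 1 c)) + √(42 * C)
  set k₂ := 8 * (A * √(C * max 1 c)) * √C * √mertensConst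
  set k₃ := 4 * √(7 * mertensConst ^ 3 * C) + 2 * √C
  have hk₁ : 0 < k₁ := by positivity
  have hk₂ : 0 ≤ k₂ := by positivity
  have hk₃ : 0 ≤ k₃ := by positivity
  refine ⟨k₁ + k₂ + k₃, Real.exp (max 4 c ^ (1 / δ)), by linarith, ?_⟩
  intro x H K a φ τ hx hH hHK hK hmul ha hφ hτ _ hms hcor
  have hH₀ := lt_of_exp_rpow_le (by positivity) hδ hx hH
  have hH4 : 4 < H := (le_max_left _ _).trans_lt hH₀
  have hcH : c < H := (le_max_right _ _).trans_lt hH₀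
  have hx1 : 1 ≤ x := (Real.one_le_exp (by positivity)).trans hx
  have hKx : K ^ 3 ≤ x := cube_le_of_lt_rpow hδ' hx1 (by linarith) hK
  have hlogH : 0 < Real.log H := Real.log_pos (by linarith)
  have hlogK : 0 < Real.log K := Real.log_pos (by linarith)
  calc _ ≤ x * (k₁ * (1 / √(H * Real.log H)) + k₂ * √τ + k₃ * (Real.log H / Real.log K)) :=
        norm_sum_le_of_bounds hA.le hC.le hτ hH4.le hcH.le hHK hKx hmul ha hφ hms hcor
    _ ≤ x * ((k₁ + k₂ + k₃) * (1 / √(H * Real.log H)) + (k₁ + k₂ + k₃) * √τ +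
        (k₁ + k₂ + k₃) * (Real.log H / Real.log K)) := by gcongr <;> linarith
    _ = _ := by ring
end
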